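/- Let α and β be partitions of n with all parts odd. Then the following are equivalent: (i) there exist a permutation w ∈ C_β with inv(w) minimal among the elements of C_β and a permutation w' ∈ C_α with inv(w') minimal among the elements of C_α such that w' ≤ w in the Bruhat order of S_n; (ii) β ≤ α in dominance order, i.e., Σ_{i=1}^k β_i ≤ Σ_{i=1}^k α_i for all k. -/

import Mathlib

/-- `inv(w) = #{1 ≤ i < j ≤ n : w(i) > w(j)}` for a permutation `w` of `{1,...,n}`
(encoded on `Fin n`, with `k : Fin n` representing the number `k+1`). -/
def invA {n : ℕ} (w : Equiv.Perm (Fin n)) : ℕ :=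
  (Finset.univ.filter (fun p : Fin n × Fin n => p.1 < p.2 ∧ w p.2 < w p.1)).card

/-- The Bruhat order on `S_n`: reflexive–transitive closure of `x → x·t`, `t` a
transposition with `inv(x·t) > inv(x)`. -/
def BruhatA {n : ℕ} (x y : Equiv.Perm (Fin n)) : Prop :=
  Relation.ReflTransGen
    (fun u v => ∃ a b : Fin n, a ≠ b ∧ v = u * Equiv.swap a b ∧ invA u < invA v) x y

/-- `w ∈ C_α` for a partition `α = (α 1 ≥ ⋯ ≥ α ℓ > 0)` of `n` with all parts odd:
there is a decomposition `{1,...,n} = I_1 ⊔ ⋯ ⊔ I_ℓ` with `|I_j| = α_j`, such that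
the orbits of `w·δ` on `{1,...,n}` are exactly the sets `I_j`.  Here
`δ = Fin.revPerm` is the longest element `i ↦ n+1−i`. -/
def MemCClassA (n ℓ : ℕ) (α : ℕ → ℕ) (w : Equiv.Perm (Fin n)) : Prop :=
  ∃ I : ℕ → Finset (Fin n),
    (∀ j, 1 ≤ j → j ≤ ℓ → (I j).card = α j) ∧
    (∀ j j', 1 ≤ j → j < j' → j' ≤ ℓ → Disjoint (I j) (I j')) ∧
    ((Finset.Icc 1 ℓ).biUnion I = Finset.univ) ∧
    (∀ j, 1 ≤ j → j ≤ ℓ → ∀ x ∈ I j, ∀ y : Fin n,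
      ((w * Fin.revPerm).SameCycle x y ↔ y ∈ I j))

namespace S17
open Finset

lemma alt_exists (P : ℕ → Prop) (p : ℕ) (hp : Odd p) (h : P 0 ↔ P p) :
    ∃ t < p, (P t ↔ P (t + 1)) := by
  by_contra hcon
  push Not at hcon
  have key : ∀ t ≤ p, (P t ↔ (P 0 ↔ Even t)) := by
    intro t
    induction t with
    | zero => intro _; simp
    | succ t ih =>
      intro ht
      have h1 := ih (by omega)
      have h2 := hcon t (by omega)
      have h3 : Even (t + 1) ↔ ¬ Even t := Nat.even_add_one
      tauto
  have h1 := key p le_rfl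
  have h2 : ¬ Even p := Nat.not_even_iff_odd.mpr hp
  tauto

lemma window_bound {X Y : Type*} (a : X → X) (b : Y → Y) (hb : Function.Injective b)
    (i0 : X) (p : ℕ) (hp : Odd p) (hper : a^[p] i0 = i0)
    (hinj : ∀ s < p, ∀ t < p, a^[s] i0 = a^[t] i0 → s = t)
    (Z : Finset (X × Y)) (hZ : ∀ z ∈ Z, (a z.1, b z.2) ∈ Z)
    (R : X → Y → Prop) [∀ x y, Decidable (R x y)] (r : Prop)
    (hr : ∀ j, (i0, j) ∈ Z → (R i0 j ↔ r))
    (B : Finset Y) (hB : ∀ j ∈ B, (i0, j) ∈ Z) :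
    B.card ≤ (Z.filter (fun z => R z.1 z.2 ↔ R (a z.1) (b z.2))).card := by
  have hmem : ∀ j ∈ B, ∀ t, (a^[t] i0, b^[t] j) ∈ Z := by
    intro j hj t
    induction t with
    | zero => exact hB j hj
    | succ t ih =>
      have := hZ _ ih
      simpa only [Function.iterate_succ_apply'] using this
  have hex : ∀ j, ∃ t, j ∈ B → t < p ∧
      (R (a^[t] i0) (b^[t] j) ↔ R (a^[t + 1] i0) (b^[t + 1] j)) := by
    intro j
    by_cases hj : j ∈ B
    · obtain ⟨t, ht, h⟩ := alt_exists (fun t => R (a^[t] i0) (b^[t] j)) p hp (by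
        have h0 := hr j (hB j hj)
        have h1 := hmem j hj p
        rw [hper] at h1
        have h2 := hr _ h1
        simp only [Function.iterate_zero, id, hper]
        tauto)
      exact ⟨t, fun _ => ⟨ht, h⟩⟩
    · exact ⟨0, fun h => absurd h hj⟩
  choose t ht using hex
  refine Finset.card_le_card_of_injOn (fun j => (a^[t j] i0, b^[t j] j)) ?_ ?_
  · intro j hj
    have hj : j ∈ B := hj
    simp only [coe_filter, Set.mem_ofPred_eq]
    refine ⟨hmem j hj _, ?_⟩
    have := (ht j hj).2
    simpa only [Function.iterate_succ_apply'] using this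
  · intro j hj j' hj' h
    have hj : j ∈ B := hj
    have hj' : j' ∈ B := hj'
    simp only [Prod.mk.injEq] at h
    have e := hinj _ (ht j hj).1 _ (ht j' hj').1 h.1
    rw [← e] at h
    exact hb.iterate _ h.2

/-- `A` is an orbit of `c`. -/
def IsOrb {n : ℕ} (c : Equiv.Perm (Fin n)) (A : Finset (Fin n)) : Prop :=
  ∀ x ∈ A, ∀ y, c.SameCycle x y ↔ y ∈ A

lemma IsOrb.map_mem {n : ℕ} {c : Equiv.Perm (Fin n)} {A : Finset (Fin n)} (h : IsOrb c A)
    {x : Fin n} (hx : x ∈ A) : c x ∈ A :=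
  (h x hx _).1 ⟨1, by simp⟩

lemma IsOrb.iter_mem {n : ℕ} {c : Equiv.Perm (Fin n)} {A : Finset (Fin n)} (h : IsOrb c A)
    {x : Fin n} (hx : x ∈ A) (t : ℕ) : c^[t] x ∈ A := by
  induction t with
  | zero => exact hx
  | succ t ih => rw [Function.iterate_succ_apply']; exact h.map_mem ih

lemma IsOrb.spec {n : ℕ} {c : Equiv.Perm (Fin n)} {A : Finset (Fin n)} (h : IsOrb c A)
    {x : Fin n} (hx : x ∈ A) :
    c^[A.card] x = x ∧ (∀ s < A.card, ∀ t < A.card, c^[s] x = c^[t] x → s = t) ∧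
    (∀ y ∈ A, ∃ t < A.card, c^[t] x = y) := by
  set p := Function.minimalPeriod c x with hp
  have hpos : 0 < p := by
    apply Function.minimalPeriod_pos_of_mem_periodicPts
    refine ⟨orderOf c, orderOf_pos c, ?_⟩
    show c^[orderOf c] x = x
    rw [← Equiv.Perm.coe_pow, pow_orderOf_eq_one]; rfl
  have hinj : ∀ s < p, ∀ t < p, c^[s] x = c^[t] x → s = t := fun s hs t ht e =>
    Function.iterate_injOn_Iio_minimalPeriod hs ht e
  have hA : A = (range p).image (fun t => c^[t] x) := by
    ext y
    simp only [mem_image, mem_range]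
    constructor
    · intro hy
      obtain ⟨i, hi, -, e⟩ := ((h x hx y).2 hy).exists_pow_eq'' 
      refine ⟨i % p, Nat.mod_lt _ hpos, ?_⟩
      rw [Function.iterate_mod_minimalPeriod_eq, ← e, Equiv.Perm.coe_pow]
    · rintro ⟨t, -, rfl⟩
      exact h.iter_mem hx t
  have hcard : A.card = p := by
    rw [hA, Finset.card_image_of_injOn, card_range]
    intro s hs t ht e
    exact hinj s (by simpa using hs) t (by simpa using ht) e
  rw [hcard]
  refine ⟨Function.iterate_minimalPeriod, hinj, ?_⟩
  intro y hy
  rw [hA] at hy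
  simpa using hy

def cost {n : ℕ} (c : Equiv.Perm (Fin n)) (A : Finset (Fin n)) (p q : ℕ) : ℕ :=
  (A.filter fun x => (x.val < p ↔ (c x).val < q)).card

lemma sum_cost {n : ℕ} (c : Equiv.Perm (Fin n)) (A : Finset (Fin n)) {ι : Type*}
    (Y : Finset ι) (b : ι → ι) (g : ι → ℕ) :
    ∑ y ∈ Y, cost c A (g y) (g (b y)) =
      ((A ×ˢ Y).filter (fun z => z.1.val < g z.2 ↔ (c z.1).val < g (b z.2))).card := by
  rw [Finset.card_filter, Finset.sum_product_right]
  refine Finset.sum_congr rfl fun y _ => ?_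
  rw [cost, Finset.card_filter]

lemma lb_out {n : ℕ} {c : Equiv.Perm (Fin n)} {A : Finset (Fin n)} (h : IsOrb c A)
    (hodd : Odd A.card) {x0 : Fin n} (hx0 : x0 ∈ A) {ι : Type*} (Y : Finset ι) (b : ι → ι)
    (hb : Function.Injective b) (hY : ∀ y ∈ Y, b y ∈ Y) (g : ι → ℕ)
    (hg : ∀ y ∈ Y, x0.val < g y) :
    Y.card ≤ ∑ y ∈ Y, cost c A (g y) (g (b y)) := by
  rw [sum_cost]
  obtain ⟨h1, h2, h3⟩ := h.spec hx0
  refine window_bound c b hb x0 A.card hodd h1 h2 (A ×ˢ Y) ?_ (fun x y => x.val < g y) True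
    ?_ Y ?_
  · rintro ⟨x, y⟩ hz
    simp only [mem_product] at hz ⊢
    exact ⟨h.map_mem hz.1, hY _ hz.2⟩
  · intro j hj
    simp only [mem_product] at hj
    simp [hg j hj.2]
  · intro j hj
    simp [hx0, hj]

lemma lb_in {n : ℕ} {c : Equiv.Perm (Fin n)} {A : Finset (Fin n)} (h : IsOrb c A)
    {ι : Type*} (Y : Finset ι) (b : ι → ι) (hY : ∀ y ∈ Y, b y ∈ Y) (g : ι → ℕ)
    (y0 : ι) (hy0 : y0 ∈ Y) (m : ℕ) (hm : Odd m) (h1 : b^[m] y0 = y0)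
    (h2 : ∀ s < m, ∀ t < m, b^[s] y0 = b^[t] y0 → s = t)
    (hg : ∀ x ∈ A, g y0 ≤ x.val) :
    A.card ≤ ∑ y ∈ Y, cost c A (g y) (g (b y)) := by
  rw [sum_cost]
  have := window_bound b c c.injective y0 m hm h1 h2 (Y ×ˢ A) (by
      rintro ⟨y, x⟩ hz
      simp only [mem_product] at hz ⊢
      exact ⟨hY _ hz.1, h.map_mem hz.2⟩) (fun y x => x.val < g y) False (by
      intro j hj
      simp only [mem_product] at hj
      simp [hg j hj.2]) A (by intro j hj; simp [hy0, hj])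
  refine this.trans (le_of_eq ?_)
  refine Finset.card_bij (fun z _ => (z.2, z.1)) ?_ ?_ ?_
  · rintro ⟨y, x⟩ hz
    simp only [mem_filter, mem_product] at hz ⊢
    tauto
  · rintro ⟨y, x⟩ _ ⟨y', x'⟩ _ e
    simp only [Prod.mk.injEq] at e ⊢
    tauto
  · rintro ⟨x, y⟩ hz
    refine ⟨(y, x), ?_, rfl⟩
    simp only [mem_filter, mem_product] at hz ⊢
    tauto

lemma finRotate_iter (m t : ℕ) (ht : t < m + 1) :
    ((finRotate (m + 1))^[t] 0).val = t := by
  induction t with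
  | zero => simp
  | succ t ih =>
    rw [Function.iterate_succ_apply']
    have := ih (by omega)
    rw [coe_finRotate_of_ne_last, this]
    intro e
    rw [e] at this
    simp at this
    omega

lemma walk_fin {n : ℕ} (c : Equiv.Perm (Fin n)) (A : Finset (Fin n)) (g : ℕ → ℕ) (m : ℕ)
    (hg : g (m + 1) = g 0) :
    ∑ t ∈ range (m + 1), cost c A (g t) (g (t + 1)) =
      ∑ j : Fin (m + 1), cost c A (g j) (g (finRotate (m + 1) j)) := by
  rw [Finset.sum_range]
  refine Finset.sum_congr rfl fun j _ => ?_
  congr 1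
  by_cases hj : j = Fin.last m
  · subst hj; simp [hg]
  · rw [coe_finRotate_of_ne_last hj]

lemma finRotate_per (m : ℕ) : (finRotate (m + 1))^[m + 1] 0 = 0 := by
  rw [Function.iterate_succ_apply']
  have : (finRotate (m + 1))^[m] 0 = Fin.last m := by
    ext; rw [finRotate_iter m m (by omega)]; simp
  rw [this]; simp

lemma finRotate_iter_all (m : ℕ) (j : Fin (m+1)) : (finRotate (m + 1))^[j.val] 0 = j := by
  ext; rw [finRotate_iter m _ j.isLt]

lemma lb_walk {n : ℕ} {c : Equiv.Perm (Fin n)} {A : Finset (Fin n)} (h : IsOrb c A)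
    (hodd : Odd A.card) (g : ℕ → ℕ) (m : ℕ) (hm : Odd m) (hg : g m = g 0) :
    min A.card m ≤ ∑ t ∈ range m, cost c A (g t) (g (t + 1)) := by
  obtain ⟨m, rfl⟩ : ∃ k, m = k + 1 := ⟨m - 1, by have := hm.pos; omega⟩
  rw [walk_fin c A g m hg]
  have hne : A.Nonempty := Finset.card_pos.mp hodd.pos
  by_cases hc : ∀ j : Fin (m + 1), (A.min' hne).val < g j
  · refine (min_le_right _ _).trans ?_
    have := lb_out h hodd (A.min'_mem hne) (univ : Finset (Fin (m + 1))) (finRotate (m + 1))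
      (finRotate (m + 1)).injective (by simp) (fun j => g j) (fun j _ => hc j)
    simpa using this
  · push Not at hc
    obtain ⟨j0, hj0⟩ := hc
    refine (min_le_left _ _).trans ?_
    refine lb_in h univ (finRotate (m + 1)) (by simp) (fun j => g j) j0 (mem_univ _) (m + 1) hm
      ?_ ?_ ?_
    · rw [← finRotate_iter_all m j0, ← Function.iterate_add_apply, add_comm (m + 1) j0.val,
        Function.iterate_add_apply, finRotate_per]
    · intro s hs t ht e
      rw [← finRotate_iter_all m j0, ← Function.iterate_add_apply, ← Function.iterate_add_apply,
        add_comm s, add_comm t, Function.iterate_add_apply, Function.iterate_add_apply] at e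
      have e := (finRotate (m+1)).injective.iterate _ e
      have e := congrArg Fin.val e
      rwa [finRotate_iter m s hs, finRotate_iter m t ht] at e
    · intro x hx
      exact hj0.trans (by exact_mod_cast A.min'_le x hx)

/-- Number of non-inverted pairs (including diagonal ones). -/
def K {n : ℕ} (c : Equiv.Perm (Fin n)) (A B : Finset (Fin n)) : ℕ :=
  ∑ y ∈ B, cost c A y.val (c y).val

lemma K_card {n : ℕ} (c : Equiv.Perm (Fin n)) (A B : Finset (Fin n)) :
    K c A B = ((A ×ˢ B).filter (fun z => z.1 < z.2 ↔ c z.1 < c z.2)).card := by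
  have := sum_cost c A B c (fun y => y.val)
  exact this

lemma K_ge_out {n : ℕ} {c : Equiv.Perm (Fin n)} {A B : Finset (Fin n)} (hA : IsOrb c A)
    (hB : IsOrb c B) (hodd : Odd A.card) {x0 : Fin n} (hx0 : x0 ∈ A)
    (h : ∀ y ∈ B, x0 < y) : B.card ≤ K c A B :=
  lb_out hA hodd hx0 B c c.injective (fun _ hy => hB.map_mem hy) (fun y => y.val) h

lemma K_ge_in {n : ℕ} {c : Equiv.Perm (Fin n)} {A B : Finset (Fin n)} (hA : IsOrb c A)
    (hB : IsOrb c B) (hodd : Odd B.card) {y0 : Fin n} (hy0 : y0 ∈ B)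
    (h : ∀ x ∈ A, y0 ≤ x) : A.card ≤ K c A B := by
  obtain ⟨h1, h2, h3⟩ := hB.spec hy0
  exact lb_in hA B c (fun _ hy => hB.map_mem hy) (fun y => y.val) y0 hy0 B.card hodd h1 h2 h

lemma K_ge_min {n : ℕ} {c : Equiv.Perm (Fin n)} {A B : Finset (Fin n)} (hA : IsOrb c A)
    (hB : IsOrb c B) (hAo : Odd A.card) (hBo : Odd B.card) :
    min A.card B.card ≤ K c A B := by
  have hne : A.Nonempty := Finset.card_pos.mp hAo.pos
  by_cases hc : ∀ y ∈ B, A.min' hne < y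
  · exact (min_le_right _ _).trans (K_ge_out hA hB hAo (A.min'_mem hne) hc)
  · push Not at hc
    obtain ⟨y0, hy0, h⟩ := hc
    exact (min_le_left _ _).trans (K_ge_in hA hB hBo hy0 fun x hx => h.trans (A.min'_le x hx))

lemma K_self_ge {n : ℕ} {c : Equiv.Perm (Fin n)} {A : Finset (Fin n)} (hA : IsOrb c A)
    (hAo : Odd A.card) : 2 * A.card - 1 ≤ K c A A := by
  have hne : A.Nonempty := Finset.card_pos.mp hAo.pos
  set x0 := A.min' hne with hx0
  have hx0m : x0 ∈ A := A.min'_mem hne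
  obtain ⟨h1, h2, h3⟩ := hA.spec hx0m
  have hb := window_bound c c c.injective x0 A.card hAo h1 h2 A.offDiag (by
      rintro ⟨x, y⟩ hz
      simp only [mem_offDiag] at hz ⊢
      exact ⟨hA.map_mem hz.1, hA.map_mem hz.2.1, fun e => hz.2.2 (c.injective e)⟩)
    (fun x y => x < y) True (by
      intro j hj
      simp only [mem_offDiag] at hj
      simp only [iff_true]
      exact lt_of_le_of_ne (A.min'_le j hj.2.1) hj.2.2) (A.erase x0) (by
      intro j hj
      simp only [mem_erase] at hj
      simp [hx0m, hj.2, Ne.symm hj.1])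
  rw [card_erase_of_mem hx0m] at hb
  have hd : (A.diag).card = A.card := by simp
  rw [K_card]
  have hsub : A.diag ∪ A.offDiag.filter (fun z => z.1 < z.2 ↔ c z.1 < c z.2) ⊆
      (A ×ˢ A).filter (fun z => z.1 < z.2 ↔ c z.1 < c z.2) := by
    rintro ⟨x, y⟩ hz
    simp only [mem_union, mem_diag, mem_filter, mem_offDiag, mem_product] at hz ⊢
    rcases hz with ⟨hx, rfl⟩ | hz
    · simp [hx]
    · tauto
  have hcard := card_le_card hsub
  rw [card_union_of_disjoint] at hcard
  · omega
  · rw [Finset.disjoint_left]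
    rintro ⟨x, y⟩ hz hz'
    simp only [mem_diag, mem_filter, mem_offDiag] at hz hz'
    exact hz'.1.2.2 hz.2

end S17

namespace S17
open Finset

lemma cost_sum {n : ℕ} (c : Equiv.Perm (Fin n)) (A : Finset (Fin n)) (p q : ℕ) :
    cost c A p q = ∑ x ∈ A, if (x.val < p ↔ (c x).val < q) then 1 else 0 := by
  rw [cost, Finset.card_filter]

lemma ind_monge (P Q P' Q' : Prop) [Decidable P] [Decidable Q] [Decidable P'] [Decidable Q']
    (h : P → Q) (h' : P' → Q') :
    (if (P ↔ Q') then 1 else 0) + (if (Q ↔ P') then 1 else 0) ≤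
    (if (P ↔ P') then 1 else 0) + (if (Q ↔ Q') then 1 else 0 : ℕ) := by
  by_cases P <;> by_cases Q <;> by_cases P' <;> by_cases Q' <;> simp_all

lemma monge {n : ℕ} (c : Equiv.Perm (Fin n)) (A : Finset (Fin n)) {p p' q q' : ℕ}
    (hp : p ≤ p') (hq : q ≤ q') :
    cost c A p q' + cost c A p' q ≤ cost c A p q + cost c A p' q' := by
  simp only [cost_sum, ← Finset.sum_add_distrib]
  refine Finset.sum_le_sum fun x _ => ?_
  exact ind_monge _ _ _ _ (fun h => lt_of_lt_of_le h hp) (fun h => lt_of_lt_of_le h hq)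

lemma monge_strict {n : ℕ} (c : Equiv.Perm (Fin n)) (A : Finset (Fin n)) {p p' q q' : ℕ}
    (hp : p ≤ p') (hq : q ≤ q') (x : Fin n) (hx : x ∈ A) (h1 : p ≤ x.val) (h2 : x.val < p')
    (h3 : q ≤ (c x).val) (h4 : (c x).val < q') :
    cost c A p q' + cost c A p' q < cost c A p q + cost c A p' q' := by
  simp only [cost_sum, ← Finset.sum_add_distrib]
  refine Finset.sum_lt_sum (fun x _ => ?_) ⟨x, hx, ?_⟩
  · exact ind_monge _ _ _ _ (fun h => lt_of_lt_of_le h hp) (fun h => lt_of_lt_of_le h hq)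
  · simp [not_lt.mpr h1, h2, not_lt.mpr h3, h4]

lemma sum_pair_split {ι : Type*} [DecidableEq ι] (Y : Finset ι) (y z : ι) (hy : y ∈ Y)
    (hz : z ∈ Y) (hyz : y ≠ z) (f : ι → ℕ) :
    ∑ x ∈ Y, f x = f y + f z + ∑ x ∈ (Y.erase y).erase z, f x := by
  rw [← Finset.add_sum_erase _ _ hy,
    ← Finset.add_sum_erase _ _ (Finset.mem_erase.mpr ⟨hyz.symm, hz⟩), add_assoc]

lemma uncross_eq {ι : Type*} [DecidableEq ι] (F : ι → ι → ℕ) (Y : Finset ι)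
    (b : Equiv.Perm ι) (y z : ι) (hy : y ∈ Y) (hz : z ∈ Y) (hyz : y ≠ z) :
    ∑ x ∈ Y, F x (b x) + (F y (b z) + F z (b y)) =
    ∑ x ∈ Y, F x ((b * Equiv.swap y z) x) + (F y (b y) + F z (b z)) := by
  rw [sum_pair_split Y y z hy hz hyz, sum_pair_split Y y z hy hz hyz]
  have : ∑ x ∈ (Y.erase y).erase z, F x ((b * Equiv.swap y z) x) =
      ∑ x ∈ (Y.erase y).erase z, F x (b x) := by
    refine Finset.sum_congr rfl fun x hx => ?_
    simp only [mem_erase] at hx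
    rw [Equiv.Perm.mul_apply, Equiv.swap_apply_of_ne_of_ne hx.2.1 hx.1]
  rw [this]
  simp only [Equiv.Perm.mul_apply, Equiv.swap_apply_left, Equiv.swap_apply_right]
  ring

lemma uncross {n : ℕ} (c : Equiv.Perm (Fin n)) (A : Finset (Fin n)) {ι : Type*} [DecidableEq ι]
    (Y : Finset ι) (b : Equiv.Perm ι) (g : ι → ℕ) (y z : ι) (hy : y ∈ Y) (hz : z ∈ Y)
    (h1 : g y ≤ g z) (h2 : g (b y) ≤ g (b z)) :
    ∑ x ∈ Y, cost c A (g x) (g ((b * Equiv.swap y z) x)) ≤ ∑ x ∈ Y, cost c A (g x) (g (b x)) := by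
  by_cases hyz : y = z
  · subst hyz; simp
  have := uncross_eq (fun x x' => cost c A (g x) (g x')) Y b y z hy hz hyz
  have := monge c A h1 h2
  skip
  omega

lemma swap_mem {ι : Type*} [DecidableEq ι] {Y : Finset ι} {b : Equiv.Perm ι}
    (hb : ∀ x ∈ Y, b x ∈ Y) {y z : ι} (hy : y ∈ Y) (hz : z ∈ Y) :
    ∀ x ∈ Y, (b * Equiv.swap y z) x ∈ Y := by
  intro x hx
  rw [Equiv.Perm.mul_apply]
  apply hb
  rw [Equiv.swap_apply_def]
  split_ifs <;> assumption

lemma inv_mem {ι : Type*} [Finite ι] {Y : Finset ι} {b : Equiv.Perm ι}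
    (hb : ∀ x ∈ Y, b x ∈ Y) : ∀ x ∈ Y, b⁻¹ x ∈ Y := by
  intro x hx
  have hs : Finset.map b.toEmbedding Y = Y := by
    apply Finset.eq_of_subset_of_card_le
    · intro z hz
      simp only [mem_map] at hz
      obtain ⟨a, ha, rfl⟩ := hz
      exact hb a ha
    · simp
  rw [← hs] at hx
  simp only [mem_map] at hx
  obtain ⟨a, ha, rfl⟩ := hx
  simpa using ha

/-- Peeling off the outermost pair. -/
lemma peel {n : ℕ} (c : Equiv.Perm (Fin n)) {ι : Type*} [DecidableEq ι] [Finite ι]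
    (Y : Finset ι) (b : Equiv.Perm ι) (hb : ∀ x ∈ Y, b x ∈ Y) (g : ι → ℕ) (y0 y1 : ι)
    (h0 : y0 ∈ Y) (h1 : y1 ∈ Y) (h01 : y0 ≠ y1) (hmin : ∀ y ∈ Y, g y0 ≤ g y)
    (hmax : ∀ y ∈ Y, g y ≤ g y1) :
    ∃ b2 : Equiv.Perm ι, (∀ x ∈ (Y.erase y0).erase y1, b2 x ∈ (Y.erase y0).erase y1) ∧
      ∀ A : Finset (Fin n), cost c A (g y0) (g y1) + cost c A (g y1) (g y0) +
        ∑ x ∈ (Y.erase y0).erase y1, cost c A (g x) (g (b2 x)) ≤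
        ∑ x ∈ Y, cost c A (g x) (g (b x)) := by
  set z := b⁻¹ y1 with hz
  have hbz : b z = y1 := by simp [hz]
  have hzY : z ∈ Y := inv_mem hb _ h1
  set b1 := b * Equiv.swap y0 z with hb1
  have hb1Y : ∀ x ∈ Y, b1 x ∈ Y := swap_mem hb h0 hzY
  have hb10 : b1 y0 = y1 := by simp [hb1, hbz]
  set z' := b1⁻¹ y0 with hz'
  have hbz' : b1 z' = y0 := by simp [hz']
  have hzY' : z' ∈ Y := inv_mem hb1Y _ h0
  have hz'0 : z' ≠ y0 := by
    intro e; rw [e, hb10] at hbz'; exact h01 hbz'.symm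
  set b2 := b1 * Equiv.swap z' y1 with hb2
  have hb2Y : ∀ x ∈ Y, b2 x ∈ Y := swap_mem hb1Y hzY' h1
  have hb21 : b2 y1 = y0 := by simp [hb2, hbz']
  have hb20 : b2 y0 = y1 := by
    rw [hb2, Equiv.Perm.mul_apply, Equiv.swap_apply_of_ne_of_ne hz'0.symm h01, hb10]
  refine ⟨b2, ?_, ?_⟩
  · intro x hx
    simp only [mem_erase] at hx ⊢
    refine ⟨?_, ?_, hb2Y x hx.2.2⟩
    · intro e; rw [← hb20] at e; exact hx.2.1 (b2.injective e)
    · intro e; rw [← hb21] at e; exact hx.1 (b2.injective e)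
  · intro A
    have e1 := uncross c A Y b g y0 z h0 hzY (hmin _ hzY) (by rw [hbz]; exact hmax _ (hb _ h0))
    have e2 := uncross c A Y b1 g z' y1 hzY' h1 (hmax _ hzY')
      (by rw [hbz']; exact hmin _ (hb1Y _ h1))
    rw [← hb1] at e1
    rw [← hb2] at e2
    rw [sum_pair_split Y y0 y1 h0 h1 h01 (fun x => cost c A (g x) (g (b2 x)))] at e2
    simp only [hb20, hb21] at e2
    omega

/-- a step up: swapping a noninverted pair lowers all costs -/
lemma cost_step {n : ℕ} (c : Equiv.Perm (Fin n)) (a b : Fin n) (hab : a < b) (h : c a < c b)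
    (p q : ℕ) : cost (c * Equiv.swap a b) univ p q ≤ cost c univ p q := by
  have key := uncross_eq (fun x y : Fin n => if (x.val < p ↔ y.val < q) then 1 else 0) univ c a b
    (mem_univ _) (mem_univ _) hab.ne
  rw [cost_sum, cost_sum]
  have := ind_monge (b.val < p) (a.val < p) ((c b).val < q) ((c a).val < q)
    (fun h' => lt_trans (by exact_mod_cast hab) h') (fun h' => lt_trans (by exact_mod_cast h) h')
  skip
  omega

lemma K_step {n : ℕ} (c : Equiv.Perm (Fin n)) (a b : Fin n) (hab : a < b) (h : c a < c b) :
    K (c * Equiv.swap a b) univ univ < K c univ univ := by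
  have h1 : K (c * Equiv.swap a b) univ univ ≤
      ∑ y : Fin n, cost c univ y.val ((c * Equiv.swap a b) y).val :=
    Finset.sum_le_sum fun y _ => cost_step c a b hab h _ _
  have key := uncross_eq (fun x y : Fin n => cost c univ x.val y.val) univ c a b
    (mem_univ _) (mem_univ _) hab.ne
  have := monge_strict c univ (p := a.val) (p' := b.val) (q := (c a).val) (q' := (c b).val)
    hab.le h.le a (mem_univ _) le_rfl hab le_rfl h
  simp only [K] at *
  omega

lemma cost_step' {n : ℕ} (c : Equiv.Perm (Fin n)) (a b : Fin n) (hab : a ≠ b)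
    (h : a < b ↔ c a < c b) (p q : ℕ) :
    cost (c * Equiv.swap a b) univ p q ≤ cost c univ p q := by
  rcases lt_or_gt_of_ne hab with h1 | h1
  · exact cost_step c a b h1 (h.1 h1) p q
  · rw [Equiv.swap_comm]
    refine cost_step c b a h1 ?_ p q
    have : c a ≠ c b := fun e => hab (c.injective e)
    have h2 : ¬ c a < c b := fun h' => absurd (h.2 h') (not_lt.mpr h1.le)
    exact lt_of_le_of_ne (not_lt.mp h2) this.symm

lemma K_step' {n : ℕ} (c : Equiv.Perm (Fin n)) (a b : Fin n) (hab : a ≠ b)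
    (h : a < b ↔ c a < c b) :
    K (c * Equiv.swap a b) univ univ < K c univ univ := by
  rcases lt_or_gt_of_ne hab with h1 | h1
  · exact K_step c a b h1 (h.1 h1)
  · rw [Equiv.swap_comm]
    refine K_step c b a h1 ?_
    have : c a ≠ c b := fun e => hab (c.injective e)
    have h2 : ¬ c a < c b := fun h' => absurd (h.2 h') (not_lt.mpr h1.le)
    exact lt_of_le_of_ne (not_lt.mp h2) this.symm

lemma K_inv {n : ℕ} (w : Equiv.Perm (Fin n)) :
    K (w * Fin.revPerm) univ univ = n + 2 * invA w := by
  rw [K_card]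
  set c := w * Fin.revPerm with hc
  set U := (univ : Finset (Fin n × Fin n)).filter (fun z => z.1 < z.2 ∧ c z.1 < c z.2) with hU
  set V := (univ : Finset (Fin n × Fin n)).filter (fun z => z.2 < z.1 ∧ c z.2 < c z.1) with hV
  have hUc : U.card = invA w := by
    rw [invA, hU]
    refine Finset.card_bij (fun z _ => (Fin.rev z.2, Fin.rev z.1)) ?_ ?_ ?_
    · rintro ⟨x, y⟩ hz
      simp only [mem_filter, mem_univ, true_and, hc, Equiv.Perm.mul_apply, Fin.revPerm_apply] at hz ⊢
      simpa using hz
    · rintro ⟨x, y⟩ _ ⟨x', y'⟩ _ e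
      simp only [Prod.mk.injEq, Fin.rev_inj] at e ⊢
      tauto
    · rintro ⟨x, y⟩ hz
      refine ⟨(Fin.rev y, Fin.rev x), ?_, by simp⟩
      simp only [mem_filter, mem_univ, true_and, hc, Equiv.Perm.mul_apply, Fin.revPerm_apply] at hz ⊢
      simpa using hz
  have hVc : V.card = U.card := by
    refine Finset.card_bij (fun z _ => (z.2, z.1)) ?_ ?_ ?_
    · rintro ⟨x, y⟩ hz
      simpa [hU, hV] using hz
    · rintro ⟨x, y⟩ _ ⟨x', y'⟩ _ e
      simp only [Prod.mk.injEq] at e ⊢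
      tauto
    · rintro ⟨x, y⟩ hz
      exact ⟨(y, x), by simpa [hU, hV] using hz, rfl⟩
  have hsplit : ((univ : Finset (Fin n)) ×ˢ (univ : Finset (Fin n))).filter
      (fun z => z.1 < z.2 ↔ c z.1 < c z.2) = (univ : Finset (Fin n)).diag ∪ (U ∪ V) := by
    ext ⟨x, y⟩
    simp only [mem_filter, mem_product, mem_univ, true_and, mem_union, mem_diag, hU, hV]
    rcases lt_trichotomy x y with h | rfl | h
    · simp [h, h.ne, not_lt.mpr h.le]
    · simp
    · have hne : c x ≠ c y := fun e => h.ne' (c.injective e)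
      simp only [h, h.ne', not_lt.mpr h.le, false_iff, not_lt, false_and, false_or, true_and]
      exact ⟨fun h' => lt_of_le_of_ne h' hne.symm, fun h' => h'.le⟩
  rw [hsplit, card_union_of_disjoint, card_union_of_disjoint, hVc, hUc]
  · simp; ring
  · rw [Finset.disjoint_left]
    rintro ⟨x, y⟩ h1 h2
    simp only [hU, hV, mem_filter, mem_univ, true_and] at h1 h2
    exact absurd h1.1 (not_lt.mpr h2.1.le)
  · rw [Finset.disjoint_left]
    rintro ⟨x, y⟩ h1 h2
    simp only [hU, hV, mem_filter, mem_univ, true_and, mem_diag, mem_union] at h1 h2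
    subst h1
    simp at h2

lemma rev_swap {n : ℕ} (u : Equiv.Perm (Fin n)) (a b : Fin n) :
    u * Equiv.swap a b * Fin.revPerm = u * Fin.revPerm * Equiv.swap (Fin.rev a) (Fin.rev b) := by
  ext x
  simp only [Equiv.Perm.mul_apply, Fin.revPerm_apply, Equiv.swap_apply_def]
  have h1 : Fin.rev x = a ↔ x = Fin.rev a := by rw [Fin.rev_eq_iff]
  have h2 : Fin.rev x = b ↔ x = Fin.rev b := by rw [Fin.rev_eq_iff]
  simp only [h1, h2]
  split_ifs <;> simp

lemma bruhat_cost {n : ℕ} (w' w : Equiv.Perm (Fin n)) (h : BruhatA w' w) (p q : ℕ) :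
    cost (w' * Fin.revPerm) univ p q ≤ cost (w * Fin.revPerm) univ p q := by
  induction h with
  | refl => exact le_rfl
  | tail _ hstep ih =>
    refine ih.trans ?_
    obtain ⟨a, b, hab, rfl, hlt⟩ := hstep
    rename_i u _
    have hK1 := K_inv u
    have hK2 := K_inv (u * Equiv.swap a b)
    rw [rev_swap] at hK2 ⊢
    set c := u * Fin.revPerm with hc
    have hab' : Fin.rev a ≠ Fin.rev b := by simpa using hab
    set d := c * Equiv.swap (Fin.rev a) (Fin.rev b) with hd
    have hcd : c = d * Equiv.swap (Fin.rev a) (Fin.rev b) := by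
      rw [hd, mul_assoc, Equiv.swap_mul_self, mul_one]
    by_cases hx : Fin.rev a < Fin.rev b ↔ d (Fin.rev a) < d (Fin.rev b)
    · rw [hcd]; exact cost_step' d _ _ hab' hx p q
    · exfalso
      have := K_step' c (Fin.rev a) (Fin.rev b) hab' (by
        have h1 : d (Fin.rev a) = c (Fin.rev b) := by simp [hd]
        have h2 : d (Fin.rev b) = c (Fin.rev a) := by simp [hd]
        rw [h1, h2] at hx
        have : c (Fin.rev a) ≠ c (Fin.rev b) := fun e => hab' (c.injective e)
        rcases lt_or_gt_of_ne this with h3 | h3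
        · simp only [h3, iff_true]
          by_contra h4
          exact hx ⟨fun h5 => absurd h5 h4, fun h5 => absurd h5 (not_lt.mpr h3.le)⟩
        · simp only [not_lt.mpr h3.le, iff_false]
          intro h4
          exact hx ⟨fun _ => h3, fun _ => h4⟩)
      rw [← hd] at this
      omega

/-- Chain of swaps of noninverted pairs. -/
def Up {n : ℕ} (c d : Equiv.Perm (Fin n)) : Prop :=
  Relation.ReflTransGen (fun u v => ∃ a b : Fin n, a ≠ b ∧ (a < b ↔ u a < u b) ∧
    v = u * Equiv.swap a b) c d

lemma Up.bruhat {n : ℕ} {c d : Equiv.Perm (Fin n)} (h : Up c d) :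
    BruhatA (d * Fin.revPerm) (c * Fin.revPerm) := by
  induction h with
  | refl => exact Relation.ReflTransGen.refl
  | tail _ hstep ih =>
    refine Relation.ReflTransGen.head ?_ ih
    obtain ⟨a, b, hab, hx, rfl⟩ := hstep
    rename_i u _
    have hK1 := K_inv (u * Fin.revPerm)
    have hK2 := K_inv (u * Equiv.swap a b * Fin.revPerm)
    have hrr : (Fin.revPerm * Fin.revPerm : Equiv.Perm (Fin n)) = 1 := by ext x; simp
    rw [mul_assoc, hrr, mul_one] at hK1 hK2
    have := K_step' u a b hab hx
    refine ⟨Fin.rev a, Fin.rev b, by simpa using hab, ?_, by omega⟩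
    rw [rev_swap, mul_assoc, Equiv.swap_mul_self, mul_one]

end S17

namespace S17
open Finset

def spF (n : ℕ) (i : Fin n) : Fin n :=
  ⟨if i.val % 2 = 0 then i.val / 2 else n - 1 - i.val / 2, by have := i.isLt; split_ifs <;> omega⟩

lemma spF_lt {n : ℕ} (i j : Fin n) (h : i < j) : spF n i < spF n j ↔ i.val % 2 = 0 := by
  have h1 : i.val < j.val := h
  have h2 := j.isLt
  rw [Fin.lt_def]
  simp only [spF]
  split_ifs <;> omega

lemma spF_inj (n : ℕ) : Function.Injective (spF n) := by
  intro i j h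
  have h' := congrArg Fin.val h
  simp only [spF] at h'
  ext
  have := i.isLt
  have := j.isLt
  split_ifs at h' <;> omega

noncomputable def sp (n : ℕ) : Equiv.Perm (Fin n) :=
  Equiv.ofBijective (spF n) (Finite.injective_iff_bijective.mp (spF_inj n))

lemma sp_lt {n : ℕ} (i j : Fin n) (h : i < j) : sp n i < sp n j ↔ i.val % 2 = 0 := spF_lt i j h

lemma sp_lt' {n : ℕ} (i j : Fin n) (h : i < j) : sp n j < sp n i ↔ i.val % 2 = 1 := by
  have h1 := sp_lt i j h
  have : sp n i ≠ sp n j := fun h' => h.ne ((sp n).injective h')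
  constructor
  · intro h2
    by_contra h3
    exact absurd (h1.2 (by omega)) (not_lt.mpr h2.le)
  · intro h2
    rcases lt_or_gt_of_ne this with h3 | h3
    · have := h1.1 h3; omega
    · exact h3

noncomputable def conj {n : ℕ} (τ : Equiv.Perm (Fin n)) : Equiv.Perm (Fin n) := sp n * τ * (sp n)⁻¹

lemma conj_sp {n : ℕ} (τ : Equiv.Perm (Fin n)) (i : Fin n) : conj τ (sp n i) = sp n (τ i) := by
  simp [conj]

lemma conj_swap {n : ℕ} (τ : Equiv.Perm (Fin n)) (a b : Fin n) :
    conj (τ * Equiv.swap a b) = conj τ * Equiv.swap (sp n a) (sp n b) := by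
  have h := Equiv.swap_apply_apply (sp n) a b
  rw [h]; simp [conj, mul_assoc]

lemma up_step {n : ℕ} (τ : Equiv.Perm (Fin n)) (a b : Fin n) (hab : a ≠ b)
    (h : sp n a < sp n b ↔ sp n (τ a) < sp n (τ b)) :
    Up (conj τ) (conj (τ * Equiv.swap a b)) := by
  apply Relation.ReflTransGen.single
  refine ⟨sp n a, sp n b, fun h' => hab ((sp n).injective h'), ?_, conj_swap τ a b⟩
  rw [conj_sp, conj_sp]; exact h

def Valid (n : ℕ) (e : ℕ → ℕ) : Prop :=
  e 0 = 0 ∧ ∀ k, (e k = n ∧ e (k+1) = n) ∨ (e k < e (k+1) ∧ e (k+1) ≤ n ∧ (e (k+1) - e k) % 2 = 1)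

lemma Valid.mono {n : ℕ} {e : ℕ → ℕ} (h : Valid n e) : Monotone e := by
  apply monotone_nat_of_le_succ
  intro k
  rcases h.2 k with h | h <;> omega

lemma Valid.le {n : ℕ} {e : ℕ → ℕ} (h : Valid n e) (k : ℕ) : e k ≤ n := by
  rcases h.2 k with h | h <;> omega

lemma Valid.ge {n : ℕ} {e : ℕ → ℕ} (h : Valid n e) (k : ℕ) : min k n ≤ e k := by
  induction k with
  | zero => simp
  | succ k ih => rcases h.2 k with h | h <;> omega

lemma Valid.par {n : ℕ} {e : ℕ → ℕ} (h : Valid n e) (k : ℕ) (hk : e k < n) : e k % 2 = k % 2 := by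
  induction k with
  | zero => rw [h.1]
  | succ k ih => rcases h.2 k with h | h <;> omega

def IsCanon {n : ℕ} (e : ℕ → ℕ) (τ : Equiv.Perm (Fin n)) : Prop :=
  ∀ k, ∀ i : Fin n, e k ≤ i.val → i.val < e (k+1) →
    (τ i).val = if i.val + 1 = e (k+1) then e k else i.val + 1

set_option maxHeartbeats 2000000 in
lemma moveA {n : ℕ} {e : ℕ → ℕ} {τ : Equiv.Perm (Fin n)} (he : Valid n e) (hc : IsCanon e τ)
    (k : ℕ) (hk : e (k+1) + 3 ≤ e (k+2)) :
    Valid n (Function.update e (k+1) (e (k+1) + 2)) ∧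
    ∃ τ' : Equiv.Perm (Fin n), IsCanon (Function.update e (k+1) (e (k+1) + 2)) τ' ∧
      Up (conj τ) (conj τ') := by
  have hm := he.mono
  have hG := he.le (k+2)
  have v0 := he.2 k
  have v1 := he.2 (k+1)
  have p0 := he.par k
  have p1 := he.par (k+1)
  obtain ⟨E, hE⟩ : ∃ E, e (k+1) = E := ⟨_, rfl⟩
  obtain ⟨f, hf⟩ : ∃ f, e k = f := ⟨_, rfl⟩
  obtain ⟨G, hGG⟩ : ∃ G, e (k+2) = G := ⟨_, rfl⟩
  rw [show k+1+1 = k+2 by rfl, hE, hGG] at v1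
  rw [hE, hf] at v0
  rw [hE] at p1 hk
  rw [hf] at p0
  rw [hGG] at hk hG
  have hGG2 : e (k+1+1) = G := hGG
  rw [hE]
  have hfE : f < E := by omega
  refine ⟨⟨?_, ?_⟩, ?_⟩
  · simp [Function.update, he.1]
  · intro j
    have := he.2 j
    by_cases h1 : j = k
    · subst h1; simp [Function.update]; omega
    · by_cases h2 : j = k + 1
      · subst h2; simp [Function.update]; omega
      · simp [Function.update, h1, h2]; omega
  · have hEn : E + 1 < n := by omega
    have hpar : f % 2 = (E - 1) % 2 := by omega
    clear v0 v1 p0 p1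
    obtain ⟨x, hx⟩ : ∃ x : Fin n, x.val = E - 1 := ⟨⟨E - 1, by omega⟩, rfl⟩
    obtain ⟨y, hy⟩ : ∃ y : Fin n, y.val = E + 1 := ⟨⟨E + 1, by omega⟩, rfl⟩
    obtain ⟨z, hz⟩ : ∃ z : Fin n, z.val = G - 1 := ⟨⟨G - 1, by omega⟩, rfl⟩
    have tx : (τ x).val = f := by
      have := hc k x (by omega) (by omega)
      rw [this, if_pos (by omega), hf]
    have ty : (τ y).val = E + 2 := by
      have := hc (k+1) y (by omega) (by omega)
      rw [this, if_neg (by omega)]; omega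
    have tz : (τ z).val = E := by
      have := hc (k+1) z (by omega) (by omega)
      rw [this, if_pos (by omega), hE]
    have hxy : x ≠ y := by intro h; have := congrArg Fin.val h; omega
    have hyz : y ≠ z := by intro h; have := congrArg Fin.val h; omega
    have hxz : x ≠ z := by intro h; have := congrArg Fin.val h; omega
    refine ⟨τ * Equiv.swap y z * Equiv.swap x y, ?_, ?_⟩
    · have ux : ((τ * Equiv.swap y z * Equiv.swap x y) x).val = E := by
        simp [tz]
      have uy : ((τ * Equiv.swap y z * Equiv.swap x y) y).val = f := by
        simp [Equiv.swap_apply_of_ne_of_ne hxy hxz, tx]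
      have uz : ((τ * Equiv.swap y z * Equiv.swap x y) z).val = E + 2 := by
        simp [Equiv.swap_apply_of_ne_of_ne hxz.symm hyz.symm, ty]
      have uo : ∀ i : Fin n, i.val ≠ E - 1 → i.val ≠ E + 1 → i.val ≠ G - 1 →
          ((τ * Equiv.swap y z * Equiv.swap x y) i) = τ i := by
        intro i h1 h2 h3
        have h1 : i ≠ x := fun h => h1 (by rw [h]; omega)
        have h2 : i ≠ y := fun h => h2 (by rw [h]; omega)
        have h3 : i ≠ z := fun h => h3 (by rw [h]; omega)
        simp [Equiv.swap_apply_of_ne_of_ne h1 h2, Equiv.swap_apply_of_ne_of_ne h2 h3]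
      have hcases : ∀ i : Fin n, (i.val = E - 1 ∧ i = x) ∨ (i.val = E + 1 ∧ i = y) ∨ (i.val = G - 1 ∧ i = z) ∨
          (i.val ≠ E - 1 ∧ i.val ≠ E + 1 ∧ i.val ≠ G - 1) := by
        intro i
        have e1 : i.val = E - 1 → i = x := fun h => Fin.ext (by omega)
        have e2 : i.val = E + 1 → i = y := fun h => Fin.ext (by omega)
        have e3 : i.val = G - 1 → i = z := fun h => Fin.ext (by omega)
        by_cases c1 : i.val = E - 1
        · exact Or.inl ⟨c1, e1 c1⟩
        by_cases c2 : i.val = E + 1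
        · exact Or.inr (Or.inl ⟨c2, e2 c2⟩)
        by_cases c3 : i.val = G - 1
        · exact Or.inr (Or.inr (Or.inl ⟨c3, e3 c3⟩))
        exact Or.inr (Or.inr (Or.inr ⟨c1, c2, c3⟩))
      clear hxy hyz hxz
      generalize τ * Equiv.swap y z * Equiv.swap x y = τ' at *
      intro j i h1 h2
      by_cases hj1 : j = k
      · subst hj1
        simp [Function.update] at h1 h2 ⊢
        rw [hf] at h1
        simp only [hf, hE, show j + 1 + 1 = j + 2 by rfl, hGG]
        rcases hcases i with ⟨q, h⟩ | ⟨q, h⟩ | ⟨q, h⟩ | ⟨g1, g2, g3⟩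
        · rw [h, ux, if_neg] <;> omega
        · rw [h, uy, if_pos] <;> omega
        · omega
        · rw [uo i g1 g2 g3]
          by_cases hi : i.val < E
          · have hlt : i.val + 1 < E := by omega
            clear g1 g2 g3
            rw [hc j i (by omega) (by omega), if_neg (by omega), if_neg (by omega)]
          · have hlt : i.val = E := by omega
            clear g1 g2 g3
            rw [hc (j+1) i (by omega) (by omega), if_neg (by omega), if_neg (by omega)]
      · by_cases hj2 : j = k + 1
        · subst hj2
          simp [Function.update] at h1 h2 ⊢
          simp only [hE, show k + 1 + 1 = k + 2 by rfl, hGG] at h2 ⊢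
          rcases hcases i with ⟨q, h⟩ | ⟨q, h⟩ | ⟨q, h⟩ | ⟨g1, g2, g3⟩
          · omega
          · omega
          · rw [h, uz, if_pos]; rw [← h]; omega
          · rw [uo i g1 g2 g3]
            have hlt : i.val + 1 < G := by omega
            clear g1 g2 g3
            rw [hc (k+1) i (by omega) (by omega), if_neg (by omega), if_neg (by omega)]
        · have e1 : Function.update e (k+1) (E+2) j = e j := by simp [Function.update, hj2]
          have e2 : Function.update e (k+1) (E+2) (j+1) = e (j+1) := by
            simp [Function.update, hj1]
          rw [e1] at h1 ⊢
          rw [e2] at h2 ⊢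
          rw [uo i, hc j i h1 h2]
          all_goals
            rcases lt_or_gt_of_ne hj1 with h | h
            · have := hm (show j + 1 ≤ k by omega)
              omega
            · have := hm (show k + 2 ≤ j by omega)
              omega
    · refine Relation.ReflTransGen.trans (up_step τ y z hyz ?_)
        (up_step (τ * Equiv.swap y z) x y hxy ?_)
      · rw [sp_lt y z (by rw [Fin.lt_def]; omega),
          sp_lt' (τ z) (τ y) (by rw [Fin.lt_def]; omega), tz]
        omega
      · simp only [Equiv.Perm.coe_mul, Function.comp_apply, Equiv.swap_apply_left,
          Equiv.swap_apply_of_ne_of_ne hxy hxz]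
        rw [sp_lt x y (by rw [Fin.lt_def]; omega),
          sp_lt (τ x) (τ z) (by rw [Fin.lt_def]; omega), tx]
        omega

set_option maxHeartbeats 2000000 in
lemma moveB {n : ℕ} {e : ℕ → ℕ} {τ : Equiv.Perm (Fin n)} (he : Valid n e) (hc : IsCanon e τ)
    (k : ℕ) (hk1 : e (k+1) + 2 = n) (hk2 : e (k+2) + 1 = n) :
    Valid n (fun j => if k + 1 ≤ j then n else e j) ∧
    ∃ τ' : Equiv.Perm (Fin n), IsCanon (fun j => if k + 1 ≤ j then n else e j) τ' ∧
      Up (conj τ) (conj τ') := by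
  have hm := he.mono
  have v0 := he.2 k
  have v1 := he.2 (k+1)
  have v2 := he.2 (k+2)
  have p0 := he.par k
  have p1 := he.par (k+1)
  obtain ⟨E, hE⟩ : ∃ E, e (k+1) = E := ⟨_, rfl⟩
  obtain ⟨f, hf⟩ : ∃ f, e k = f := ⟨_, rfl⟩
  rw [hE] at hk1
  have hE2 : e (k+2) = E + 1 := by omega
  rw [show k+1+1 = k+2 by rfl, hE, hE2] at v1
  rw [hE2] at v2
  rw [hE, hf] at v0
  rw [hE] at p1
  rw [hf] at p0
  have hE3 : e (k+3) = n := by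
    rw [show k+2+1=k+3 by rfl] at v2; omega
  have hE22 : e (k+1+1) = E + 1 := hE2
  have hE33 : e (k+2+1) = n := hE3
  have hfE : f < E := by omega
  refine ⟨⟨?_, ?_⟩, ?_⟩
  · simp [he.1]
  · intro j
    have := he.2 j
    by_cases h1 : j = k
    · subst h1; simp; omega
    · by_cases h2 : k + 1 ≤ j
      · simp [h2, show k + 1 ≤ j + 1 by omega]
      · simp [h2, show ¬ k ≤ j by omega]; omega
  · have hpar : f % 2 = (E - 1) % 2 := by omega
    clear v0 v1 v2 p0 p1
    obtain ⟨x, hx⟩ : ∃ x : Fin n, x.val = E - 1 := ⟨⟨E - 1, by omega⟩, rfl⟩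
    obtain ⟨y, hy⟩ : ∃ y : Fin n, y.val = E + 1 := ⟨⟨E + 1, by omega⟩, rfl⟩
    obtain ⟨z, hz⟩ : ∃ z : Fin n, z.val = E := ⟨⟨E, by omega⟩, rfl⟩
    have tx : (τ x).val = f := by
      have := hc k x (by omega) (by omega)
      rw [this, if_pos (by omega), hf]
    have ty : (τ y).val = E + 1 := by
      have := hc (k+2) y (by omega) (by omega)
      rw [this, if_pos (by omega), hE2]
    have tz : (τ z).val = E := by
      have := hc (k+1) z (by omega) (by omega)
      rw [this, if_pos (by omega), hE]
    have hxy : x ≠ y := by intro h; have := congrArg Fin.val h; omega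
    have hyz : y ≠ z := by intro h; have := congrArg Fin.val h; omega
    have hxz : x ≠ z := by intro h; have := congrArg Fin.val h; omega
    refine ⟨τ * Equiv.swap y z * Equiv.swap x y, ?_, ?_⟩
    · have ux : ((τ * Equiv.swap y z * Equiv.swap x y) x).val = E := by
        simp [tz]
      have uy : ((τ * Equiv.swap y z * Equiv.swap x y) y).val = f := by
        simp [Equiv.swap_apply_of_ne_of_ne hxy hxz, tx]
      have uz : ((τ * Equiv.swap y z * Equiv.swap x y) z).val = E + 1 := by
        simp [Equiv.swap_apply_of_ne_of_ne hxz.symm hyz.symm, ty]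
      have uo : ∀ i : Fin n, i.val ≠ E - 1 → i.val ≠ E + 1 → i.val ≠ E →
          ((τ * Equiv.swap y z * Equiv.swap x y) i) = τ i := by
        intro i h1 h2 h3
        have h1 : i ≠ x := fun h => h1 (by rw [h]; omega)
        have h2 : i ≠ y := fun h => h2 (by rw [h]; omega)
        have h3 : i ≠ z := fun h => h3 (by rw [h]; omega)
        simp [Equiv.swap_apply_of_ne_of_ne h1 h2, Equiv.swap_apply_of_ne_of_ne h2 h3]
      have hcases : ∀ i : Fin n, (i.val = E - 1 ∧ i = x) ∨ (i.val = E + 1 ∧ i = y) ∨ (i.val = E ∧ i = z) ∨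
          (i.val ≠ E - 1 ∧ i.val ≠ E + 1 ∧ i.val ≠ E) := by
        intro i
        have e1 : i.val = E - 1 → i = x := fun h => Fin.ext (by omega)
        have e2 : i.val = E + 1 → i = y := fun h => Fin.ext (by omega)
        have e3 : i.val = E → i = z := fun h => Fin.ext (by omega)
        by_cases c1 : i.val = E - 1
        · exact Or.inl ⟨c1, e1 c1⟩
        by_cases c2 : i.val = E + 1
        · exact Or.inr (Or.inl ⟨c2, e2 c2⟩)
        by_cases c3 : i.val = E
        · exact Or.inr (Or.inr (Or.inl ⟨c3, e3 c3⟩))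
        exact Or.inr (Or.inr (Or.inr ⟨c1, c2, c3⟩))
      clear hxy hyz hxz
      generalize τ * Equiv.swap y z * Equiv.swap x y = τ' at *
      intro j i h1 h2
      have hin := i.isLt
      by_cases hj1 : j = k
      · subst hj1
        simp at h1 h2 ⊢
        rw [hf] at h1
        simp only [hf]
        rcases hcases i with ⟨q, h⟩ | ⟨q, h⟩ | ⟨q, h⟩ | ⟨g1, g2, g3⟩
        · rw [h, ux, if_neg] <;> rw [← h] <;> omega
        · rw [h, uy, if_pos]; rw [← h]; omega
        · rw [h, uz, if_neg] <;> rw [← h] <;> omega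
        · rw [uo i g1 g2 g3]
          have hlt : i.val + 1 < E := by omega
          clear g1 g2 g3
          rw [hc j i (by omega) (by omega), if_neg (by omega), if_neg (by omega)]
      · by_cases hj2 : k + 1 ≤ j
        · simp [hj2] at h1; omega
        · simp only [hj2, if_false, show ¬ (k + 1 ≤ j + 1) by omega] at h1 h2 ⊢
          have := hm (show j + 1 ≤ k by omega)
          rw [uo i (by omega) (by omega) (by omega), hc j i h1 h2]
    · refine Relation.ReflTransGen.trans (up_step τ y z hyz ?_)
        (up_step (τ * Equiv.swap y z) x y hxy ?_)
      · have e1 : τ y = y := Fin.ext (by omega)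
        have e2 : τ z = z := Fin.ext (by omega)
        rw [e1, e2]
      · simp only [Equiv.Perm.coe_mul, Function.comp_apply, Equiv.swap_apply_left,
          Equiv.swap_apply_of_ne_of_ne hxy hxz]
        rw [sp_lt x y (by rw [Fin.lt_def]; omega),
          sp_lt (τ x) (τ z) (by rw [Fin.lt_def]; omega), tx]
        omega

lemma chain {n : ℕ} (hn : 1 ≤ n) {e' : ℕ → ℕ} (he' : Valid n e') : ∀ (N : ℕ) (e : ℕ → ℕ) (τ : Equiv.Perm (Fin n)),
    Valid n e → IsCanon e τ → (∀ k, e k ≤ e' k) → ∑ k ∈ range n, (e' k - e k) = N →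
    ∃ τ', IsCanon e' τ' ∧ Up (conj τ) (conj τ') := by
  intro N
  induction N using Nat.strong_induction_on with
  | _ N ih =>
  intro e τ he hc hle hN
  have main : ∀ e1 : ℕ → ℕ, (Valid n e1 ∧ ∃ τ' : Equiv.Perm (Fin n), IsCanon e1 τ' ∧ Up (conj τ) (conj τ')) →
      (∀ k, e1 k ≤ e' k) → (∀ k, e k ≤ e1 k) → (∃ k < n, e k < e1 k) →
      ∃ τ', IsCanon e' τ' ∧ Up (conj τ) (conj τ') := by
    rintro e1 ⟨hv, τ1, hc1, hu⟩ h1 h2 ⟨k, hk, hk2⟩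
    have hlt : ∑ k ∈ range n, (e' k - e1 k) < N := by
      rw [← hN]
      apply sum_lt_sum
      · intro j _; have := h2 j; omega
      · exact ⟨k, mem_range.mpr hk, by have := h1 k; omega⟩
    obtain ⟨τ2, hc2, hu2⟩ := ih _ hlt e1 τ1 hv hc1 h1 rfl
    exact ⟨τ2, hc2, hu.trans hu2⟩
  by_cases hall : ∀ k, e k = e' k
  · have : e = e' := funext hall
    subst this
    exact ⟨τ, hc, Relation.ReflTransGen.refl⟩
  push Not at hall
  obtain ⟨k0, hk0⟩ := hall
  have hlarge : ∀ k, n ≤ k → e k = e' k := by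
    intro k hk
    have a1 := he.le k
    have a2 := he.ge k
    have a3 := he'.le k
    have a4 := he'.ge k
    omega
  obtain ⟨k, hk, hkmax⟩ : ∃ k, e k < e' k ∧ ∀ j, k < j → e j = e' j := by
    have h0 : e k0 < e' k0 := lt_of_le_of_ne (hle k0) hk0
    have hb : ∀ j, e j < e' j → j ≤ n := by
      intro j hj; by_contra h; have := hlarge j (by omega); omega
    refine ⟨Nat.findGreatest (fun j => e j < e' j) n, ?_, ?_⟩
    · exact Nat.findGreatest_spec (P := fun j => e j < e' j) (hb k0 h0) h0
    · intro j hj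
      by_contra h
      have h1 : e j < e' j := lt_of_le_of_ne (hle j) h
      have := Nat.le_findGreatest (P := fun j => e j < e' j) (hb j h1) h1
      omega
  have hkn : k < n := by
    by_contra h; have := hlarge k (by omega); omega
  have hk1 : k ≠ 0 := by
    rintro rfl; have := he.1; have := he'.1; omega
  obtain ⟨k, rfl⟩ := Nat.exists_eq_succ_of_ne_zero hk1
  simp only [Nat.succ_eq_add_one] at *
  have hG := hkmax (k+2) (by omega)
  have doA : ∀ j, e (j+1) + 3 ≤ e (j+2) → e (j+1) + 2 ≤ e' (j+1) → j + 1 < n → 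
      ∃ τ', IsCanon e' τ' ∧ Up (conj τ) (conj τ') := by
    intro j h1 h2 h3
    refine main _ (moveA he hc j h1) ?_ ?_ ⟨j+1, h3, by simp⟩
    · intro i
      by_cases hi : i = j + 1
      · subst hi; simpa using h2
      · simpa [Function.update, hi] using hle i
    · intro i
      by_cases hi : i = j + 1
      · subst hi; simp
      · simp [Function.update, hi]
  have v := he.2 (k+1)
  have v' := he'.2 (k+1)
  have u := he.2 k
  have u' := he'.2 k
  have l1 := he.le (k+1)
  have l1' := he'.le (k+1)
  have l2' := he'.le (k+2)
  have q := he.par (k+1)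
  have q0 := he.par k
  have q' := he'.par (k+1)
  have q0' := he'.par k
  simp only [show k + 1 + 1 = k + 2 by rfl] at *
  by_cases hc1 : e' (k+1) < n
  · exact doA k (by omega) (by omega) (by omega)
  · have hk0 : e' k = n := by omega
    by_cases hc2 : e (k+1) + 3 ≤ n
    · exact doA k (by omega) (by omega) (by omega)
    · have hkk : k ≠ 0 := by rintro rfl; have := he'.1; omega
      obtain ⟨k, rfl⟩ := Nat.exists_eq_succ_of_ne_zero hkk
      simp only [Nat.succ_eq_add_one, show k + 1 + 1 = k + 2 by rfl] at *
      by_cases hc3 : e (k+1) + 4 ≤ n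
      · exact doA k (by omega) (by omega) (by omega)
      · have hB1 : e (k+1) + 2 = n := by omega
        have hB2 : e (k+2) + 1 = n := by omega
        refine main _ (moveB he hc k hB1 hB2) ?_ ?_ ⟨k+1, by omega, ?_⟩
        · intro i
          by_cases hi : k + 1 ≤ i
          · have := he'.mono hi; simp [hi]; omega
          · simp [hi]; exact hle i
        · intro i
          by_cases hi : k + 1 ≤ i
          · simp [hi]; exact he.le i
          · simp [hi]
        · simp; omega

lemma exists_canon {n : ℕ} (hn : 1 ≤ n) {e' : ℕ → ℕ} (he' : Valid n e') :
    ∃ τ' : Equiv.Perm (Fin n), IsCanon e' τ' := by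
  have hv : Valid n (fun k => min k n) := by
    refine ⟨by simp, fun k => ?_⟩
    simp only
    omega
  obtain ⟨τ', h, _⟩ := chain hn he' _ (fun k => min k n) 1 hv (by
    intro k i h1 h2
    simp only at h1 h2 ⊢
    have := i.isLt
    simp only [Equiv.Perm.coe_one, id]
    split_ifs <;> omega) (fun k => he'.ge k) rfl
  exact ⟨τ', h⟩

end S17

namespace S17
open Finset

structure IsDec {n : ℕ} (l : ℕ) (β : ℕ → ℕ) (c : Equiv.Perm (Fin n)) (I : ℕ → Finset (Fin n)) : Prop where
  card : ∀ j, 1 ≤ j → j ≤ l → (I j).card = β j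
  disj : ∀ j j', 1 ≤ j → j < j' → j' ≤ l → Disjoint (I j) (I j')
  un : (Finset.Icc 1 l).biUnion I = Finset.univ
  orb : ∀ j, 1 ≤ j → j ≤ l → IsOrb c (I j)

lemma IsDec.pw {n l : ℕ} {β : ℕ → ℕ} {c : Equiv.Perm (Fin n)} {I : ℕ → Finset (Fin n)}
    (h : IsDec l β c I) : Set.PairwiseDisjoint (↑(Icc 1 l) : Set ℕ) I := by
  intro i hi j hj hij
  rw [mem_coe, mem_Icc] at hi hj
  rcases lt_or_gt_of_ne hij with h1 | h1
  · exact h.disj i j hi.1 h1 hj.2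
  · exact (h.disj j i hj.1 h1 hi.2).symm

lemma IsDec.sum_univ {n l : ℕ} {β : ℕ → ℕ} {c : Equiv.Perm (Fin n)} {I : ℕ → Finset (Fin n)}
    (h : IsDec l β c I) (f : Fin n → ℕ) : ∑ x, f x = ∑ j ∈ Icc 1 l, ∑ x ∈ I j, f x := by
  rw [← h.un, sum_biUnion h.pw]

lemma IsDec.cost_univ {n l : ℕ} {β : ℕ → ℕ} {c : Equiv.Perm (Fin n)} {I : ℕ → Finset (Fin n)}
    (h : IsDec l β c I) (p q : ℕ) : cost c univ p q = ∑ j ∈ Icc 1 l, cost c (I j) p q := by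
  rw [cost_sum, h.sum_univ]
  exact sum_congr rfl fun j _ => (cost_sum c (I j) p q).symm

lemma IsDec.K_univ {n l : ℕ} {β : ℕ → ℕ} {c : Equiv.Perm (Fin n)} {I : ℕ → Finset (Fin n)}
    (h : IsDec l β c I) : K c univ univ = ∑ i ∈ Icc 1 l, ∑ j ∈ Icc 1 l, K c (I i) (I j) := by
  unfold K
  rw [h.sum_univ, sum_comm]
  refine sum_congr rfl fun j _ => ?_
  rw [sum_comm]
  exact sum_congr rfl fun y _ => h.cost_univ _ _

def MM (β : ℕ → ℕ) (i j : ℕ) : ℕ := if i = j then 2 * β i - 1 else min (β i) (β j)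

lemma IsDec.K_ge {n l : ℕ} {β : ℕ → ℕ} {c : Equiv.Perm (Fin n)} {I : ℕ → Finset (Fin n)}
    (h : IsDec l β c I) (hodd : ∀ i, 1 ≤ i → i ≤ l → Odd (β i)) (i j : ℕ)
    (hi : i ∈ Icc 1 l) (hj : j ∈ Icc 1 l) : MM β i j ≤ K c (I i) (I j) := by
  rw [mem_Icc] at hi hj
  have oi := hodd i hi.1 hi.2
  have oj := hodd j hj.1 hj.2
  have ci := h.card i hi.1 hi.2
  have cj := h.card j hj.1 hj.2
  unfold MM
  split_ifs with hij
  · subst hij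
    rw [← ci]
    exact K_self_ge (h.orb i hi.1 hi.2) (by rw [ci]; exact oi)
  · rw [← ci, ← cj]
    exact K_ge_min (h.orb i hi.1 hi.2) (h.orb j hj.1 hj.2) (by rw [ci]; exact oi) (by rw [cj]; exact oj)

lemma IsDec.K_lower {n l : ℕ} {β : ℕ → ℕ} {c : Equiv.Perm (Fin n)} {I : ℕ → Finset (Fin n)}
    (h : IsDec l β c I) (hodd : ∀ i, 1 ≤ i → i ≤ l → Odd (β i)) :
    ∑ i ∈ Icc 1 l, ∑ j ∈ Icc 1 l, MM β i j ≤ K c univ univ := by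
  rw [h.K_univ]
  exact sum_le_sum fun i hi => sum_le_sum fun j hj => h.K_ge hodd i j hi hj

lemma IsDec.tight {n l : ℕ} {β : ℕ → ℕ} {c : Equiv.Perm (Fin n)} {I : ℕ → Finset (Fin n)}
    (h : IsDec l β c I) (hodd : ∀ i, 1 ≤ i → i ≤ l → Odd (β i))
    (hK : K c univ univ ≤ ∑ i ∈ Icc 1 l, ∑ j ∈ Icc 1 l, MM β i j) (i j : ℕ)
    (hi : i ∈ Icc 1 l) (hj : j ∈ Icc 1 l) : K c (I i) (I j) = MM β i j := by
  rw [h.K_univ] at hK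
  have h1 := (sum_eq_sum_iff_of_le (fun i hi => sum_le_sum fun j hj => h.K_ge hodd i j hi hj)).mp
    (le_antisymm (sum_le_sum fun i hi => sum_le_sum fun j hj => h.K_ge hodd i j hi hj) hK) i hi
  exact ((sum_eq_sum_iff_of_le (fun j hj => h.K_ge hodd i j hi hj)).mp h1 j hj).symm

def blk {n : ℕ} (e : ℕ → ℕ) (k : ℕ) : Finset (Fin n) :=
  univ.filter fun i => e k ≤ i.val ∧ i.val < e (k+1)

lemma mem_blk {n : ℕ} {e : ℕ → ℕ} {k : ℕ} {i : Fin n} :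
    i ∈ (blk e k : Finset (Fin n)) ↔ e k ≤ i.val ∧ i.val < e (k+1) := by simp [blk]

lemma blk_card {n : ℕ} {e : ℕ → ℕ} (k : ℕ) (he : e (k+1) ≤ n) :
    (blk e k : Finset (Fin n)).card = e (k+1) - e k := by
  rw [← Nat.card_Ico, ← card_map Fin.valEmbedding]
  congr 1
  ext x
  simp only [mem_map, mem_blk, Fin.valEmbedding_apply, mem_Ico]
  constructor
  · rintro ⟨i, hi, rfl⟩; exact hi
  · intro hx; exact ⟨⟨x, by omega⟩, hx, rfl⟩

lemma canon_cases {n : ℕ} {e : ℕ → ℕ} {τ : Equiv.Perm (Fin n)} (hc : IsCanon e τ) {k : ℕ} {i : Fin n}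
    (hi : i ∈ (blk e k : Finset (Fin n))) :
    (i.val + 1 = e (k+1) ∧ (τ i).val = e k) ∨ (i.val + 1 < e (k+1) ∧ (τ i).val = i.val + 1) := by
  rw [mem_blk] at hi
  have := hc k i hi.1 hi.2
  split_ifs at this with h
  · exact Or.inl ⟨h, this⟩
  · right; omega

lemma canon_map {n : ℕ} {e : ℕ → ℕ} {τ : Equiv.Perm (Fin n)} (hc : IsCanon e τ) {k : ℕ} {i : Fin n}
    (hi : i ∈ (blk e k : Finset (Fin n))) : τ i ∈ (blk e k : Finset (Fin n)) := by
  have h1 := canon_cases hc hi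
  rw [mem_blk] at hi ⊢
  omega

lemma canon_orb {n : ℕ} {e : ℕ → ℕ} {τ : Equiv.Perm (Fin n)} (hc : IsCanon e τ) (k : ℕ) :
    IsOrb τ (blk e k) := by
  have first : ∀ t : ℕ, ∀ x y : Fin n, x.val = e k → y.val = e k + t → y.val < e (k+1) →
      τ.SameCycle x y := by
    intro t
    induction t with
    | zero =>
      intro x y hx hy _
      have : x = y := Fin.ext (by omega)
      rw [this]
    | succ t ih =>
      intro x y hx hy hlt
      have hyn := y.isLt
      have h1 := ih x ⟨e k + t, by omega⟩ hx rfl (by simp; omega)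
      have h2 := canon_cases hc (k := k) (i := ⟨e k + t, by omega⟩) (by rw [mem_blk]; simp; omega)
      have h3 : τ ⟨e k + t, by omega⟩ = y := by
        apply Fin.ext
        simp only at h2
        omega
      rw [← h3]
      exact h1.apply_right
  intro x hx y
  constructor
  · rintro h
    obtain ⟨t, _, rfl⟩ := h.exists_pow_eq'
    have hall : ∀ t : ℕ, (τ ^ t) x ∈ (blk e k : Finset (Fin n)) := by
      intro t
      induction t with
      | zero => simpa using hx
      | succ t ih =>
        rw [pow_succ', Equiv.Perm.mul_apply]
        exact canon_map hc ih
    exact hall t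
  · intro hy
    rw [mem_blk] at hx hy
    have hxn := x.isLt
    have a := first (x.val - e k) ⟨e k, by omega⟩ x rfl (by omega) hx.2
    have b := first (y.val - e k) ⟨e k, by omega⟩ y rfl (by omega) hy.2
    exact a.symm.trans b

noncomputable def Iset (n : ℕ) (e : ℕ → ℕ) (j : ℕ) : Finset (Fin n) := (blk e (j-1)).map (sp n).toEmbedding

lemma conj_orb {n : ℕ} {τ : Equiv.Perm (Fin n)} {A : Finset (Fin n)} (h : IsOrb τ A) :
    IsOrb (conj τ) (A.map (sp n).toEmbedding) := by
  intro x hx y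
  rw [mem_map] at hx
  obtain ⟨x, hx, rfl⟩ := hx
  unfold conj
  rw [Equiv.Perm.sameCycle_conj]
  have e1 : (sp n)⁻¹ ((sp n).toEmbedding x) = x := (sp n).symm_apply_apply x
  rw [e1]
  rw [h x hx]
  rw [mem_map_equiv]
  rfl

lemma K_map {n : ℕ} (τ : Equiv.Perm (Fin n)) (A B : Finset (Fin n)) :
    K (conj τ) (A.map (sp n).toEmbedding) (B.map (sp n).toEmbedding) =
      ((A ×ˢ B).filter fun z => (sp n z.1 < sp n z.2 ↔ sp n (τ z.1) < sp n (τ z.2))).card := by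
  rw [K_card]
  symm
  apply card_bij (fun z _ => (sp n z.1, sp n z.2))
  · intro z hz
    simp only [mem_filter, mem_product] at hz ⊢
    refine ⟨⟨mem_map_of_mem _ hz.1.1, mem_map_of_mem _ hz.1.2⟩, ?_⟩
    rw [conj_sp, conj_sp]; exact hz.2
  · intro z _ z' _ h
    simp only [Prod.mk.injEq, EmbeddingLike.apply_eq_iff_eq] at h
    exact Prod.ext h.1 h.2
  · rintro ⟨x, y⟩ hz
    simp only [mem_filter, mem_product, mem_map] at hz
    obtain ⟨⟨⟨x, hx, rfl⟩, ⟨y, hy, rfl⟩⟩, h⟩ := hz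
    refine ⟨(x, y), ?_, rfl⟩
    simp only [Equiv.coe_toEmbedding] at h
    rw [conj_sp, conj_sp] at h
    simp only [mem_filter, mem_product]
    exact ⟨⟨hx, hy⟩, h⟩

lemma K_lt {n : ℕ} {e : ℕ → ℕ} {τ : Equiv.Perm (Fin n)} (he : Valid n e) (hc : IsCanon e τ)
    {i j : ℕ} (hij : i < j) :
    ((blk e i ×ˢ blk e j).filter fun z => (sp n z.1 < sp n z.2 ↔ sp n (τ z.1) < sp n (τ z.2))).card
      ≤ (blk e j : Finset (Fin n)).card := by
  apply card_le_card_of_injOn (fun z => z.2)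
  · intro z hz
    simp only [coe_filter, Set.mem_ofPred_eq, mem_product] at hz
    exact hz.1.2
  · have key : ∀ z ∈ ((blk e i ×ˢ blk e j).filter fun z => (sp n z.1 < sp n z.2 ↔ sp n (τ z.1) < sp n (τ z.2))),
        z.1.val + 1 = e (i+1) := by
      intro z hz
      simp only [mem_filter, mem_product] at hz
      obtain ⟨⟨h1, h2⟩, h3⟩ := hz
      have t1 := canon_map hc h1
      have t2 := canon_map hc h2
      have c1 := canon_cases hc h1
      rw [mem_blk] at h1 h2 t1 t2
      have := he.mono (show i + 1 ≤ j by omega)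
      rw [sp_lt _ _ (by rw [Fin.lt_def]; omega), sp_lt _ _ (by rw [Fin.lt_def]; omega)] at h3
      omega
    intro z hz z' hz' h
    have h1 := key z hz
    have h2 := key z' hz'
    exact Prod.ext (Fin.ext (by omega)) h

lemma K_gt {n : ℕ} {e : ℕ → ℕ} {τ : Equiv.Perm (Fin n)} (he : Valid n e) (hc : IsCanon e τ)
    {i j : ℕ} (hij : j < i) :
    ((blk e i ×ˢ blk e j).filter fun z => (sp n z.1 < sp n z.2 ↔ sp n (τ z.1) < sp n (τ z.2))).card
      ≤ (blk e i : Finset (Fin n)).card := by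
  apply card_le_card_of_injOn (fun z => z.1)
  · intro z hz
    simp only [coe_filter, Set.mem_ofPred_eq, mem_product] at hz
    exact hz.1.1
  · have key : ∀ z ∈ ((blk e i ×ˢ blk e j).filter fun z => (sp n z.1 < sp n z.2 ↔ sp n (τ z.1) < sp n (τ z.2))),
        z.2.val + 1 = e (j+1) := by
      intro z hz
      simp only [mem_filter, mem_product] at hz
      obtain ⟨⟨h1, h2⟩, h3⟩ := hz
      have t1 := canon_map hc h1
      have t2 := canon_map hc h2
      have c2 := canon_cases hc h2
      rw [mem_blk] at h1 h2 t1 t2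
      have := he.mono (show j + 1 ≤ i by omega)
      rw [sp_lt' _ _ (by rw [Fin.lt_def]; omega), sp_lt' _ _ (by rw [Fin.lt_def]; omega)] at h3
      omega
    intro z hz z' hz' h
    have h1 := key z hz
    have h2 := key z' hz'
    exact Prod.ext h (Fin.ext (by omega))

lemma K_eq {n : ℕ} {e : ℕ → ℕ} {τ : Equiv.Perm (Fin n)} (hc : IsCanon e τ)
    (i : ℕ) (b : ℕ) (hb : e (i+1) = e i + (2 * b + 1)) (hn : e (i+1) ≤ n) :
    ((blk e i ×ˢ blk e i).filter fun z => (sp n z.1 < sp n z.2 ↔ sp n (τ z.1) < sp n (τ z.2))).card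
      ≤ (2 * b + 1) + b + b := by
  have hsub : ∀ z ∈ ((blk e i ×ˢ blk e i).filter fun z : Fin n × Fin n =>
      (sp n z.1 < sp n z.2 ↔ sp n (τ z.1) < sp n (τ z.2))),
      (z.1 = z.2 ∧ e i ≤ z.1.val ∧ z.1.val < e (i+1)) ∨
      (z.2.val + 1 = e (i+1) ∧ (z.1.val - e i) % 2 = 1 ∧ z.1.val < e (i+1)) ∨
      (z.1.val + 1 = e (i+1) ∧ (z.2.val - e i) % 2 = 1 ∧ z.2.val < e (i+1)) := by
    intro z hz
    simp only [mem_filter, mem_product] at hz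
    obtain ⟨⟨h1, h2⟩, h3⟩ := hz
    have t1 := canon_map hc h1
    have t2 := canon_map hc h2
    have c1 := canon_cases hc h1
    have c2 := canon_cases hc h2
    rw [mem_blk] at h1 h2 t1 t2
    rcases lt_trichotomy z.1 z.2 with h | h | h
    · have h' : z.1.val < z.2.val := h
      right; left
      rw [sp_lt _ _ h] at h3
      by_cases hl : z.2.val + 1 = e (i+1)
      · rw [sp_lt' _ _ (by rw [Fin.lt_def]; omega)] at h3
        omega
      · rw [sp_lt _ _ (by rw [Fin.lt_def]; omega)] at h3
        omega
    · exact Or.inl ⟨h, h1⟩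
    · have h' : z.2.val < z.1.val := h
      right; right
      rw [sp_lt' _ _ h] at h3
      by_cases hl : z.1.val + 1 = e (i+1)
      · rw [sp_lt _ _ (by rw [Fin.lt_def]; omega)] at h3
        omega
      · rw [sp_lt' _ _ (by rw [Fin.lt_def]; omega)] at h3
        omega
  have : ((2 * b + 1) + b + b) = ((range (2 * b + 1)).disjSum ((range b).disjSum (range b))).card := by
    simp [card_disjSum]; omega
  rw [this]
  apply card_le_card_of_injOn (fun z => if z.1 = z.2 then Sum.inl (z.1.val - e i) else
    if z.2.val + 1 = e (i+1) then Sum.inr (Sum.inl ((z.1.val - e i) / 2))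
    else Sum.inr (Sum.inr ((z.2.val - e i) / 2)))
  · intro z hz
    have := hsub z hz
    simp only
    split_ifs with h1 h2
    · simp [h1] at this ⊢
      have : z.1.val = z.2.val := by rw [h1]
      omega
    · have h1' : z.1.val ≠ z.2.val := fun h => h1 (Fin.ext h)
      simp
      omega
    · have h1' : z.1.val ≠ z.2.val := fun h => h1 (Fin.ext h)
      simp
      omega
  · intro z hz z' hz' h
    have g := hsub z hz
    have g' := hsub z' hz'
    simp only at h
    suffices z.1.val = z'.1.val ∧ z.2.val = z'.2.val from Prod.ext (Fin.ext this.1) (Fin.ext this.2)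
    split_ifs at h with h1 h2 h3 h4 h5 h6
    all_goals simp only [Sum.inl.injEq, Sum.inr.injEq, reduceCtorEq] at h
    all_goals simp only [Fin.ext_iff] at *
    all_goals omega

def pre (β : ℕ → ℕ) (k : ℕ) : ℕ := ∑ i ∈ Icc 1 k, β i

lemma pre_succ (β : ℕ → ℕ) (k : ℕ) : pre β (k+1) = pre β k + β (k+1) := by
  unfold pre
  rw [sum_Icc_succ_top (by omega)]

lemma pre_le {n l : ℕ} {β : ℕ → ℕ} (hsupp : ∀ i, l < i → β i = 0) (hsum : pre β l = n) (k : ℕ) :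
    pre β k ≤ n ∧ (l ≤ k → pre β k = n) := by
  have h1 : ∀ k, l ≤ k → pre β k = n := by
    intro k hk
    induction k, hk using Nat.le_induction with
    | base => exact hsum
    | succ k hk ih => rw [pre_succ, ih, hsupp _ (by omega), add_zero]
  have hm : Monotone (pre β) := monotone_nat_of_le_succ fun k => by rw [pre_succ]; omega
  refine ⟨?_, h1 k⟩
  rcases le_total l k with h | h
  · exact (h1 k h).le
  · rw [← hsum]; exact hm h

lemma pre_valid {n l : ℕ} {β : ℕ → ℕ} (hsupp : ∀ i, l < i → β i = 0) (hsum : pre β l = n)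
    (hodd : ∀ i, 1 ≤ i → i ≤ l → Odd (β i)) : Valid n (pre β) := by
  refine ⟨by simp [pre], fun k => ?_⟩
  by_cases hk : l ≤ k
  · exact Or.inl ⟨(pre_le hsupp hsum k).2 hk, (pre_le hsupp hsum (k+1)).2 (by omega)⟩
  · right
    have h1 := (pre_le hsupp hsum (k+1)).1
    obtain ⟨b, hb⟩ := hodd (k+1) (by omega) (by omega)
    rw [pre_succ] at h1 ⊢
    omega

lemma canon_dec {n l : ℕ} {β : ℕ → ℕ} (hsupp : ∀ i, l < i → β i = 0) (hsum : pre β l = n)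
    (hodd : ∀ i, 1 ≤ i → i ≤ l → Odd (β i)) {τ : Equiv.Perm (Fin n)} (hc : IsCanon (pre β) τ) :
    IsDec l β (conj τ) (Iset n (pre β)) := by
  have hv := pre_valid hsupp hsum hodd
  refine ⟨?_, ?_, ?_, ?_⟩
  · intro j h1 h2
    obtain ⟨j, rfl⟩ := Nat.exists_eq_succ_of_ne_zero (show j ≠ 0 by omega)
    rw [Iset, card_map, Nat.succ_eq_add_one, Nat.add_sub_cancel, blk_card _ (hv.le _), pre_succ]
    omega
  · intro j j' h1 h2 h3
    rw [Iset, Iset, disjoint_map, disjoint_left]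
    intro x hx hx'
    rw [mem_blk] at hx hx'
    have := hv.mono (show j - 1 + 1 ≤ j' - 1 by omega)
    omega
  · ext x
    simp only [mem_univ, iff_true, mem_biUnion, mem_Icc, Iset, mem_map]
    obtain ⟨y, rfl⟩ := (sp n).surjective x
    have hex : ∃ k, y.val < pre β k := ⟨l, by rw [hsum]; exact y.isLt⟩
    have hs := Nat.find_spec hex
    have hmin := fun m => Nat.find_min (m := m) hex
    have hle : Nat.find hex ≤ l := Nat.find_min' hex (by rw [hsum]; exact y.isLt)
    set k := Nat.find hex
    have hk0 : k ≠ 0 := by intro h; rw [h] at hs; simp [pre] at hs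
    refine ⟨k, ⟨by omega, hle⟩, y, ?_, rfl⟩
    rw [mem_blk, show k - 1 + 1 = k by omega]
    exact ⟨not_lt.mp (hmin (k-1) (by omega)), hs⟩
  · intro j _ _
    exact conj_orb (canon_orb hc _)

lemma canon_K {n l : ℕ} {β : ℕ → ℕ} (hmono : ∀ i, 1 ≤ i → i < l → β (i + 1) ≤ β i)
    (hsupp : ∀ i, l < i → β i = 0) (hsum : pre β l = n)
    (hodd : ∀ i, 1 ≤ i → i ≤ l → Odd (β i)) {τ : Equiv.Perm (Fin n)} (hc : IsCanon (pre β) τ) :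
    K (conj τ) univ univ ≤ ∑ i ∈ Icc 1 l, ∑ j ∈ Icc 1 l, MM β i j := by
  have hv := pre_valid hsupp hsum hodd
  have hd := canon_dec hsupp hsum hodd hc
  have hanti : ∀ i j, 1 ≤ i → i ≤ j → j ≤ l → β j ≤ β i := by
    intro i j hi hij
    induction j, hij using Nat.le_induction with
    | base => intro _; exact le_rfl
    | succ j hj ih => intro h; exact (hmono j (by omega) (by omega)).trans (ih (by omega))
  rw [hd.K_univ]
  refine sum_le_sum fun i hi => sum_le_sum fun j hj => ?_
  rw [mem_Icc] at hi hj
  have ci := hd.card i hi.1 hi.2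
  have cj := hd.card j hj.1 hj.2
  unfold Iset at ci cj ⊢
  rw [card_map] at ci cj
  rw [K_map]
  unfold MM
  rcases lt_trichotomy i j with h | h | h
  · rw [if_neg h.ne, min_eq_right (hanti i j hi.1 h.le hj.2), ← cj]
    exact K_lt hv hc (by omega)
  · subst h
    rw [if_pos rfl]
    obtain ⟨b, hb⟩ := hodd i hi.1 hi.2
    have := pre_succ β (i-1)
    have h2 := K_eq hc (i-1) b (by rw [this, show i - 1 + 1 = i by omega, hb]) (hv.le _)
    refine h2.trans ?_
    omega
  · rw [if_neg h.ne', min_eq_left (hanti j i hj.1 h.le hi.2), ← ci]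
    exact K_gt hv hc (by omega)

end S17

namespace S17
open Finset

lemma orb_sum {n : ℕ} {c : Equiv.Perm (Fin n)} {D : Finset (Fin n)} (hD : IsOrb c D)
    {y0 : Fin n} (hy0 : y0 ∈ D) (f : Fin n → ℕ) :
    ∑ y ∈ D, f y = ∑ t ∈ range D.card, f (c^[t] y0) := by
  obtain ⟨h1, h2, h3⟩ := hD.spec hy0
  symm
  apply sum_bij (fun t _ => c^[t] y0)
  · intro t _; exact hD.iter_mem hy0 t
  · intro s hs t ht h; exact h2 s (mem_range.mp hs) t (mem_range.mp ht) h
  · intro y hy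
    obtain ⟨t, ht, h⟩ := h3 y hy
    exact ⟨t, mem_range.mpr ht, h⟩
  · intro _ _; rfl

lemma cost_shift {n : ℕ} (c : Equiv.Perm (Fin n)) (A : Finset (Fin n)) (y : Fin n) (hy : y ∉ A)
    (a b : ℕ) (ha : a ≤ 1) (hb : b ≤ 1) :
    cost c A (y.val + a) ((c y).val + b) = cost c A y.val (c y).val := by
  unfold cost
  congr 1
  apply filter_congr
  intro x hx
  have hxy : x ≠ y := fun h => hy (h ▸ hx)
  have h1 : x.val ≠ y.val := fun h => hxy (Fin.ext h)
  have h2 : (c x).val ≠ (c y).val := fun h => hxy (c.injective (Fin.ext h))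
  omega

lemma cost_shift_le {n : ℕ} (c : Equiv.Perm (Fin n)) (A : Finset (Fin n)) (y : Fin n)
    (a b : ℕ) (ha : a ≤ 1) (hb : b ≤ 1) :
    cost c A (y.val + a) ((c y).val + b) ≤ cost c A y.val (c y).val := by
  unfold cost
  apply card_le_card
  intro x hx
  rw [mem_filter] at hx ⊢
  refine ⟨hx.1, ?_⟩
  by_cases hxy : x = y
  · subst hxy; simp
  have h1 : x.val ≠ y.val := fun h => hxy (Fin.ext h)
  have h2 : (c x).val ≠ (c y).val := fun h => hxy (c.injective (Fin.ext h))
  omega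

lemma cost_shift_lt {n : ℕ} (c : Equiv.Perm (Fin n)) (A : Finset (Fin n)) (y : Fin n) (hy : y ∈ A)
    (a b : ℕ) (hab : a + b = 1) :
    cost c A (y.val + a) ((c y).val + b) + 1 ≤ cost c A y.val (c y).val := by
  unfold cost
  apply card_lt_card
  rw [ssubset_iff_of_subset]
  · refine ⟨y, by simp [hy], ?_⟩
    simp [hy]
    omega
  · intro x hx
    rw [mem_filter] at hx ⊢
    refine ⟨hx.1, ?_⟩
    by_cases hxy : x = y
    · subst hxy; simp
    have h1 : x.val ≠ y.val := fun h => hxy (Fin.ext h)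
    have h2 : (c x).val ≠ (c y).val := fun h => hxy (c.injective (Fin.ext h))
    omega

lemma orb_walk_out {n : ℕ} {c : Equiv.Perm (Fin n)} {D A : Finset (Fin n)} (hD : IsOrb c D)
    (hodd : Odd D.card) {y0 : Fin n} (hy0 : y0 ∈ D) (hA : Disjoint A D) (e0 : ℕ) (he0 : e0 ≤ 1)
    (g : ℕ → ℕ) (hg : ∀ t < D.card, g t = (c^[t] y0).val + (t + e0) % 2) (hq : g D.card = y0.val + e0) :
    ∑ t ∈ range D.card, cost c A (g t) (g (t+1)) = K c A D := by
  rw [K, orb_sum hD hy0]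
  refine sum_congr rfl fun t ht => ?_
  rw [mem_range] at ht
  have hn : c^[t] y0 ∉ A := fun h => disjoint_left.mp hA h (hD.iter_mem hy0 t)
  rw [hg t ht]
  by_cases hl : t + 1 < D.card
  · rw [hg (t+1) hl, Function.iterate_succ_apply']
    exact cost_shift c A _ hn _ _ (by omega) (by omega)
  · have : t + 1 = D.card := by omega
    have h1 := (hD.spec hy0).1
    rw [← this, Function.iterate_succ_apply'] at h1
    rw [this, hq]
    have := cost_shift c A (c^[t] y0) hn ((t+e0) % 2) e0 (by omega) (by omega)
    rw [h1] at this ⊢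
    exact this

lemma orb_walk_in {n : ℕ} {c : Equiv.Perm (Fin n)} {D : Finset (Fin n)} (hD : IsOrb c D)
    (hodd : Odd D.card) {y0 : Fin n} (hy0 : y0 ∈ D) (e0 : ℕ) (he0 : e0 ≤ 1)
    (g : ℕ → ℕ) (hg : ∀ t < D.card, g t = (c^[t] y0).val + (t + e0) % 2) (hq : g D.card = y0.val + e0) :
    ∑ t ∈ range D.card, cost c D (g t) (g (t+1)) + D.card ≤ K c D D + 1 := by
  rw [K, orb_sum hD hy0]
  have key : ∀ t ∈ range D.card, cost c D (g t) (g (t+1)) + 1 ≤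
      cost c D (c^[t] y0).val (c (c^[t] y0)).val + if t = D.card - 1 then 1 else 0 := by
    intro t ht
    rw [mem_range] at ht
    have hn := hD.iter_mem hy0 t
    rw [hg t ht]
    by_cases hl : t + 1 < D.card
    · rw [hg (t+1) hl, Function.iterate_succ_apply', if_neg (by omega)]
      exact cost_shift_lt c D _ hn _ _ (by omega)
    · have : t + 1 = D.card := by omega
      have h1 := (hD.spec hy0).1
      rw [← this, Function.iterate_succ_apply'] at h1
      rw [this, hq, if_pos (by omega)]
      have := cost_shift_le c D (c^[t] y0) ((t+e0) % 2) e0 (by omega) (by omega)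
      rw [h1] at this ⊢
      omega
  have := sum_le_sum key
  rw [sum_add_distrib, sum_add_distrib, sum_ite_eq'] at this
  have hp := hodd.pos
  rw [if_pos (by rw [mem_range]; omega)] at this
  simpa using this

lemma loop_exists {n : ℕ} (c : Equiv.Perm (Fin n)) {ι : Type*} [DecidableEq ι] [Finite ι] (l : ℕ)
    (g : ι → ℕ) (u : ℕ) (hu : ∀ p q, u < p → u < q → 2 * l ≤ cost c univ p q + cost c univ q p) :
    ∀ (k : ℕ) (Y : Finset ι) (b : Equiv.Perm ι), Y.card = 2 * k + 1 → (∀ x ∈ Y, b x ∈ Y) →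
      (∀ x ∈ Y, u < g x) →
      ∑ x ∈ Y, cost c univ (g x) (g (b x)) ≤ l * Y.card → ∃ h, cost c univ h h ≤ l := by
  intro k
  induction k with
  | zero =>
    intro Y b hY hb _ hs
    obtain ⟨y, rfl⟩ := card_eq_one.mp (by omega : Y.card = 1)
    have := hb y (by simp)
    rw [mem_singleton] at this
    simp [this] at hs
    exact ⟨_, hs⟩
  | succ k ih =>
    intro Y b hY hb hgu hs
    obtain ⟨y0, hy0, hmin⟩ := exists_min_image Y g (card_pos.mp (by omega))
    have hc0 := card_erase_of_mem hy0
    obtain ⟨y1, hy1, hmax⟩ := exists_max_image (Y.erase y0) g (card_pos.mp (by omega))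
    have hy1' := mem_erase.mp hy1
    have hc1 := card_erase_of_mem hy1
    obtain ⟨b2, hb2, hA⟩ := peel c Y b hb g y0 y1 hy0 hy1'.2 hy1'.1.symm hmin (by
      intro y hy
      by_cases h : y = y0
      · rw [h]; exact hmin _ hy1'.2
      · exact hmax y (mem_erase.mpr ⟨h, hy⟩))
    have h1 := hA univ
    have h2 := hu _ _ (hgu y0 hy0) (hgu y1 hy1'.2)
    refine ih ((Y.erase y0).erase y1) b2 (by omega) hb2
      (fun x hx => hgu x (mem_of_mem_erase (mem_of_mem_erase hx))) ?_
    have h3 : l * Y.card = l * ((Y.erase y0).erase y1).card + 2 * l := by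
      have : Y.card = ((Y.erase y0).erase y1).card + 2 := by omega
      rw [this]; ring
    omega

lemma caseA {n l : ℕ} {β : ℕ → ℕ} {c : Equiv.Perm (Fin n)} {I : ℕ → Finset (Fin n)} (hl : 1 ≤ l)
    (hd : IsDec l β c I) (hodd : ∀ i, 1 ≤ i → i ≤ l → Odd (β i))
    (ht : ∀ i ∈ Icc 1 l, ∀ j ∈ Icc 1 l, K c (I i) (I j) = MM β i j) :
    ∃ h, cost c univ h h ≤ l := by
  have hmin : ∀ j ∈ Icc 1 l, ∃ x ∈ I j, ∀ y ∈ I j, x ≤ y := by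
    intro j hj
    rw [mem_Icc] at hj
    have : (I j).Nonempty := card_pos.mp (by rw [hd.card j hj.1 hj.2]; exact (hodd j hj.1 hj.2).pos)
    exact ⟨(I j).min' this, min'_mem _ _, fun y hy => min'_le _ y hy⟩
  have : Nonempty (Fin n) := by
    obtain ⟨x, _⟩ := hmin 1 (by simp [hl]); exact ⟨x⟩
  choose! μ hμ hμ' using hmin
  obtain ⟨j0, hj0, hmax⟩ := exists_max_image (Icc 1 l) μ ⟨1, by simp [hl]⟩
  have hj0' := mem_Icc.mp hj0
  set y0 := μ j0 with hy0
  set D := I j0 with hDdef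
  have hyD : y0 ∈ D := hμ j0 hj0
  have hD : IsOrb c D := hd.orb j0 hj0'.1 hj0'.2
  have hcard : D.card = β j0 := hd.card j0 hj0'.1 hj0'.2
  have hDo : Odd D.card := by rw [hcard]; exact hodd j0 hj0'.1 hj0'.2
  obtain ⟨k, hk⟩ := hDo
  set g : ℕ → ℕ := fun t => if t < D.card then (c^[t] y0).val + (t+1) % 2 else y0.val + 1 with hg
  have hg1 : ∀ t < D.card, g t = (c^[t] y0).val + (t + 1) % 2 := by
    intro t h; simp only [hg, if_pos h]
  have hg2 : g D.card = y0.val + 1 := by simp [hg]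
  have hgu : ∀ t, y0.val < g t := by
    intro t
    by_cases h : t < D.card
    · rw [hg1 t h]
      have h1 : y0 ≤ c^[t] y0 := hμ' j0 hj0 _ (hD.iter_mem hyD t)
      have h1' : y0.val ≤ (c^[t] y0).val := h1
      by_cases h0 : t = 0
      · subst h0; simp
      · have h2 : c^[t] y0 ≠ c^[0] y0 := fun h' => h0 ((hD.spec hyD).2.1 t h 0 (by omega) h')
        have h3 : (c^[t] y0).val ≠ y0.val := fun h' => h2 (Fin.ext h')
        omega
    · simp [hg, h]
  have hu : ∀ p q, y0.val < p → y0.val < q → 2 * l ≤ cost c univ p q + cost c univ q p := by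
    intro p q hp hq
    rw [hd.cost_univ, hd.cost_univ, ← sum_add_distrib]
    have : 2 * l = ∑ j ∈ Icc 1 l, 2 := by simp [mul_comm]
    rw [this]
    refine sum_le_sum fun j hj => ?_
    have hj' := mem_Icc.mp hj
    have := lb_out (hd.orb j hj'.1 hj'.2) (by rw [hd.card j hj'.1 hj'.2]; exact hodd j hj'.1 hj'.2)
      (hμ j hj) (univ : Finset Bool) not Bool.not_injective (by simp) (fun x => if x then p else q)
      (by
        have h1 : (μ j).val ≤ y0.val := hmax j hj
        intro y _
        cases y <;> simp <;> omega)
    simpa using this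
  have htot : ∑ t ∈ range D.card, cost c univ (g t) (g (t+1)) ≤ l * D.card := by
    simp only [hd.cost_univ]
    rw [sum_comm]
    have : l * D.card = ∑ j ∈ Icc 1 l, D.card := by simp
    rw [this]
    refine sum_le_sum fun j hj => ?_
    have hj' := mem_Icc.mp hj
    by_cases hjj : j = j0
    · subst hjj
      have := orb_walk_in hD ⟨k, hk⟩ hyD 1 le_rfl g hg1 hg2
      have hp : 0 < D.card := by omega
      rw [hDdef] at this ⊢ hcard hp
      rw [ht j hj j hj, MM, if_pos rfl, ← hcard] at this
      omega
    · have hdis : Disjoint (I j) D := hd.pw hj hj0 hjj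
      rw [orb_walk_out hD ⟨k, hk⟩ hyD hdis 1 le_rfl g hg1 hg2, ht j hj j0 hj0, MM, if_neg hjj, hcard]
      exact min_le_right _ _
  rw [hk, walk_fin c univ g (2*k) (by rw [← hk, hg2]; rw [hg1 0 (by omega)]; simp)] at htot
  exact loop_exists c l (fun j : Fin (2*k+1) => g j) y0.val hu k univ (finRotate (2*k+1)) (by simp)
    (by simp) (fun x _ => hgu x) (by simpa using htot)

lemma caseB {n l : ℕ} {β : ℕ → ℕ} {c : Equiv.Perm (Fin n)} {I : ℕ → Finset (Fin n)}
    (hd : IsDec l β c I) (hodd : ∀ i, 1 ≤ i → i ≤ l → Odd (β i))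
    (ht : ∀ i ∈ Icc 1 l, ∀ j ∈ Icc 1 l, K c (I i) (I j) = MM β i j) (m : ℕ) (hm : Odd m)
    (hex : ∃ j ∈ Icc 1 l, β j ≤ m) :
    ∃ g : ℕ → ℕ, g m = g 0 ∧
      ∑ t ∈ range m, cost c univ (g t) (g (t+1)) ≤ ∑ j ∈ Icc 1 l, min (β j) m := by
  set J := (Icc 1 l).filter (fun j => β j ≤ m) with hJ
  have hJsub : J ⊆ Icc 1 l := filter_subset _ _
  have hpw : Set.PairwiseDisjoint (↑J : Set ℕ) I := hd.pw.subset (by exact_mod_cast hJsub)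
  set S := J.biUnion I with hS
  have hmapS : ∀ y ∈ S, c y ∈ S := by
    intro y hy
    rw [hS, mem_biUnion] at hy ⊢
    obtain ⟨j, hj, hy⟩ := hy
    have := mem_Icc.mp (hJsub hj)
    exact ⟨j, hj, (hd.orb j this.1 this.2).map_mem hy⟩
  have hSne : S.Nonempty := by
    obtain ⟨j, hj, hjm⟩ := hex
    have hj' := mem_Icc.mp hj
    have : (I j).Nonempty := card_pos.mp (by rw [hd.card j hj'.1 hj'.2]; exact (hodd j hj'.1 hj'.2).pos)
    obtain ⟨x, hx⟩ := this
    exact ⟨x, mem_biUnion.mpr ⟨j, mem_filter.mpr ⟨hj, hjm⟩, hx⟩⟩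
  obtain ⟨y0, hy0, hmin⟩ := exists_min_image S id hSne
  obtain ⟨y1, hy1, hmax⟩ := exists_max_image S id hSne
  simp only [id] at hmin hmax
  obtain ⟨j0, hj0J, hyD⟩ := mem_biUnion.mp hy0
  have hj0 := hJsub hj0J
  have hj0' := mem_Icc.mp hj0
  have hj0m : β j0 ≤ m := (mem_filter.mp hj0J).2
  set D := I j0 with hDdef
  have hD : IsOrb c D := hd.orb j0 hj0'.1 hj0'.2
  have hcard : D.card = β j0 := hd.card j0 hj0'.1 hj0'.2
  have hDo : Odd D.card := by rw [hcard]; exact hodd j0 hj0'.1 hj0'.2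
  -- cost bounds
  have small : ∀ j ∈ J, cost c (I j) y0.val (y1.val + 1) = 0 ∧ cost c (I j) (y1.val + 1) y0.val = 0 := by
    intro j hj
    have hb : ∀ x ∈ I j, y0.val ≤ x.val ∧ x.val ≤ y1.val ∧ y0.val ≤ (c x).val ∧ (c x).val ≤ y1.val := by
      intro x hx
      have hxS : x ∈ S := mem_biUnion.mpr ⟨j, hj, hx⟩
      exact ⟨hmin x hxS, hmax x hxS, hmin _ (hmapS x hxS), hmax _ (hmapS x hxS)⟩
    constructor
    all_goals
      unfold cost
      rw [card_eq_zero, filter_eq_empty_iff]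
      intro x hx
      have := hb x hx
      omega
  have big : ∀ j ∈ Icc 1 l, j ∉ J →
      cost c (I j) y0.val (y1.val + 1) + cost c (I j) (y1.val + 1) y0.val ≤ 2 := by
    intro j hj hjJ
    have hj' := mem_Icc.mp hj
    have hjm : m < β j := by
      by_contra h
      exact hjJ (mem_filter.mpr ⟨hj, by omega⟩)
    have hne : ∀ i ∈ J, j ≠ i := fun i hi h => hjJ (h ▸ hi)
    have hcj := hd.card j hj'.1 hj'.2
    have hEo : Odd (I j).card := by rw [hcj]; exact hodd j hj'.1 hj'.2
    have hE := hd.orb j hj'.1 hj'.2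
    have hdisj : ∀ x ∈ I j, x ∉ S := by
      intro x hx hxS
      obtain ⟨i, hi, hxi⟩ := mem_biUnion.mp hxS
      exact disjoint_left.mp (hd.pw hj (hJsub hi) (hne i hi)) hx hxi
    have hshift : ∀ p, (cost c (I j) p (y1.val + 1) = cost c (I j) p y1.val) ∧
        (cost c (I j) (y1.val + 1) p = cost c (I j) y1.val p) := by
      intro p
      have h1 : ∀ x ∈ I j, x.val ≠ y1.val := fun x hx h => hdisj x hx (by rw [Fin.ext h]; exact hy1)
      unfold cost
      constructor
      · congr 1
        apply filter_congr
        intro x hx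
        have := h1 _ (hE.map_mem hx)
        omega
      · congr 1
        apply filter_congr
        intro x hx
        have := h1 _ hx
        omega
    rw [(hshift _).1, (hshift _).2]
    have hKS : ∑ y ∈ S, cost c (I j) y.val (c y).val = S.card := by
      rw [hS, sum_biUnion hpw, card_biUnion hpw]
      refine sum_congr rfl fun i hi => ?_
      have hi' := mem_Icc.mp (hJsub hi)
      have := ht j hj i (hJsub hi)
      rw [K, MM, if_neg (hne i hi)] at this
      rw [this, hd.card i hi'.1 hi'.2]
      have := (mem_filter.mp hi).2
      omega
    by_cases h01 : y0 = y1
    · have hSs : S = {y0} := by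
        ext x
        rw [mem_singleton]
        constructor
        · intro hx
          exact le_antisymm (h01 ▸ hmax x hx) (hmin x hx)
        · rintro rfl; exact hy0
      have hcy : c y0 = y0 := by
        have := hmapS y0 hy0
        rwa [hSs, mem_singleton] at this
      rw [hSs, sum_singleton, card_singleton, hcy] at hKS
      rw [← h01]; omega
    · have hx0 : ∃ x0 ∈ I j, x0 < y0 := by
        by_contra h
        push Not at h
        have h1 := K_ge_in hE hD hDo hyD h
        rw [ht j hj j0 hj0, MM, if_neg (hne j0 hj0J), hcj] at h1
        omega
      obtain ⟨x0, hx0, hlt⟩ := hx0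
      obtain ⟨b2, hb2, hA⟩ := peel c S c hmapS (fun y => y.val) y0 y1 hy0 hy1 h01
        (fun y hy => hmin y hy) (fun y hy => hmax y hy)
      have h1 := hA (I j)
      rw [hKS] at h1
      have h2 := lb_out hE hEo hx0 ((S.erase y0).erase y1) b2 b2.injective hb2 (fun y => y.val) (by
        intro y hy
        have : y0 ≤ y := hmin y (mem_of_mem_erase (mem_of_mem_erase hy))
        exact lt_of_lt_of_le hlt this)
      rw [card_erase_of_mem (mem_erase.mpr ⟨fun h => h01 h.symm, hy1⟩), card_erase_of_mem hy0] at h2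
      omega
  -- the walk
  set g : ℕ → ℕ := fun t => if t < D.card then (c^[t] y0).val + (t+0) % 2 else
    if (t - D.card) % 2 = 0 then y0.val else y1.val + 1 with hg
  have hg1 : ∀ t < D.card, g t = (c^[t] y0).val + (t + 0) % 2 := by
    intro t h; simp only [hg, if_pos h]
  have hg2 : g D.card = y0.val + 0 := by simp [hg]
  have hgs : ∀ s, g (D.card + s) = if s % 2 = 0 then y0.val else y1.val + 1 := by
    intro s; simp [hg]
  obtain ⟨r, hr⟩ : ∃ r, m = D.card + 2 * r := by
    obtain ⟨a, ha⟩ := hm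
    obtain ⟨b, hb⟩ := hDo
    exact ⟨a - b, by omega⟩
  refine ⟨g, ?_, ?_⟩
  · rw [hr, hgs, hg1 0 hDo.pos]; simp
  · have htail : ∀ (A : Finset (Fin n)) (r : ℕ), ∑ s ∈ range (2 * r), cost c A (g (D.card + s)) (g (D.card + s + 1)) =
        r * (cost c A y0.val (y1.val + 1) + cost c A (y1.val + 1) y0.val) := by
      intro A r
      induction r with
      | zero => simp
      | succ r ih =>
        rw [show 2 * (r+1) = 2 * r + 1 + 1 by ring, sum_range_succ, sum_range_succ, ih]
        rw [add_assoc D.card, add_assoc D.card, hgs, hgs, hgs]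
        rw [if_pos (by omega), if_neg (by omega), if_pos (by omega)]
        ring
    simp only [hd.cost_univ]
    rw [sum_comm]
    refine sum_le_sum fun j hj => ?_
    have hj' := mem_Icc.mp hj
    have hhead : ∑ t ∈ range D.card, cost c (I j) (g t) (g (t+1)) ≤ min (β j) D.card := by
      by_cases hjj : j = j0
      · subst hjj
        have := orb_walk_in hD hDo hyD 0 (by omega) g hg1 hg2
        have hp := hDo.pos
        rw [hDdef] at this ⊢ hp hcard
        rw [ht j hj j hj, MM, if_pos rfl] at this
        omega
      · have hdis : Disjoint (I j) D := hd.pw hj hj0 hjj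
        rw [orb_walk_out hD hDo hyD hdis 0 (by omega) g hg1 hg2, ht j hj j0 hj0, MM, if_neg hjj, hcard]
    rw [hr, sum_range_add, htail]
    by_cases hjJ : j ∈ J
    · rw [(small j hjJ).1, (small j hjJ).2]
      simp only [add_zero, mul_zero]
      omega
    · have h2 := big j hj hjJ
      have h3 := Nat.mul_le_mul_left r h2
      have hjm : m < β j := by
        by_contra h
        exact hjJ (mem_filter.mpr ⟨hj, by omega⟩)
      omega

lemma walk_exists {n l : ℕ} {β : ℕ → ℕ} {c : Equiv.Perm (Fin n)} {I : ℕ → Finset (Fin n)} (hl : 1 ≤ l)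
    (hd : IsDec l β c I) (hodd : ∀ i, 1 ≤ i → i ≤ l → Odd (β i))
    (ht : ∀ i ∈ Icc 1 l, ∀ j ∈ Icc 1 l, K c (I i) (I j) = MM β i j) (m : ℕ) (hm : Odd m) :
    ∃ g : ℕ → ℕ, g m = g 0 ∧
      ∑ t ∈ range m, cost c univ (g t) (g (t+1)) ≤ ∑ j ∈ Icc 1 l, min (β j) m := by
  by_cases hex : ∃ j ∈ Icc 1 l, β j ≤ m
  · exact caseB hd hodd ht m hm hex
  · push Not at hex
    obtain ⟨h, hh⟩ := caseA hl hd hodd ht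
    refine ⟨fun _ => h, rfl, ?_⟩
    have : ∑ j ∈ Icc 1 l, min (β j) m = l * m := by
      rw [sum_congr rfl (fun j hj => min_eq_right (hex j hj).le)]; simp
    rw [this]
    simp only [sum_const, card_range, smul_eq_mul]
    rw [mul_comm l]
    exact Nat.mul_le_mul_left m hh

lemma phi_le {n l l' : ℕ} {α β : ℕ → ℕ} {c c' : Equiv.Perm (Fin n)} {I I' : ℕ → Finset (Fin n)} (hl : 1 ≤ l)
    (hd : IsDec l β c I) (hodd : ∀ i, 1 ≤ i → i ≤ l → Odd (β i))
    (ht : ∀ i ∈ Icc 1 l, ∀ j ∈ Icc 1 l, K c (I i) (I j) = MM β i j)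
    (hd' : IsDec l' α c' I') (hodd' : ∀ i, 1 ≤ i → i ≤ l' → Odd (α i))
    (hcc : ∀ p q, cost c' univ p q ≤ cost c univ p q) (m : ℕ) (hm : Odd m) :
    ∑ i ∈ Icc 1 l', min (α i) m ≤ ∑ j ∈ Icc 1 l, min (β j) m := by
  obtain ⟨g, hg, h⟩ := walk_exists hl hd hodd ht m hm
  refine le_trans ?_ h
  refine le_trans ?_ (sum_le_sum fun t _ => hcc _ _)
  simp only [hd'.cost_univ]
  rw [sum_comm]
  refine sum_le_sum fun j hj => ?_
  have hj' := mem_Icc.mp hj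
  have := lb_walk (hd'.orb j hj'.1 hj'.2) (by rw [hd'.card j hj'.1 hj'.2]; exact hodd' j hj'.1 hj'.2) g m hm hg
  rwa [hd'.card j hj'.1 hj'.2] at this

lemma dom_of_phi {n la lb : ℕ} {α β : ℕ → ℕ} (hamono : ∀ i, 1 ≤ i → i < la → α (i + 1) ≤ α i)
    (hasupp : ∀ i, la < i → α i = 0) (hasum : pre α la = n)
    (haodd : ∀ i, 1 ≤ i → i ≤ la → Odd (α i))
    (hbsupp : ∀ i, lb < i → β i = 0) (hbsum : pre β lb = n)
    (h : ∀ m, Odd m → ∑ i ∈ Icc 1 la, min (α i) m ≤ ∑ j ∈ Icc 1 lb, min (β j) m) (k : ℕ) :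
    pre β k ≤ pre α k := by
  by_cases hk : la ≤ k
  · rw [(pre_le hasupp hasum k).2 hk]; exact (pre_le hbsupp hbsum k).1
  · by_cases hk0 : k = 0
    · subst hk0; simp [pre]
    have hanti : ∀ i j, 1 ≤ i → i ≤ j → j ≤ la → α j ≤ α i := by
      intro i j hi hij
      induction j, hij using Nat.le_induction with
      | base => intro _; exact le_rfl
      | succ j hj ih => intro h; exact (hamono j (by omega) (by omega)).trans (ih (by omega))
    set m := α k with hm
    have hmo : Odd m := haodd k (by omega) (by omega)
    have h1 := h m hmo
    -- tails
    have tail : ∀ (γ : ℕ → ℕ) (l : ℕ), (∀ i, l < i → γ i = 0) → ∀ L, l ≤ L →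
        ∑ i ∈ Icc 1 l, min (γ i) m = ∑ i ∈ Icc 1 L, min (γ i) m := by
      intro γ l hγ L hL
      apply sum_subset
      · intro x hx; rw [mem_Icc] at hx ⊢; omega
      · intro x hx hx'
        rw [mem_Icc] at hx hx'
        rw [hγ x (by omega)]; simp
    set L := max la lb
    have hL1 : la ≤ L := le_max_left _ _
    have hL2 : lb ≤ L := le_max_right _ _
    rw [tail α la hasupp L hL1, tail β lb hbsupp L hL2] at h1
    have hpa := (pre_le hasupp hasum L).2 hL1
    have hpb := (pre_le hbsupp hbsum L).2 hL2
    have split : ∀ f : ℕ → ℕ, ∑ i ∈ Icc 1 L, f i = ∑ i ∈ Icc 1 k, f i + ∑ i ∈ Ioc k L, f i := by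
      intro f
      rw [← sum_union]
      · congr 1; ext x; simp only [mem_union, mem_Icc, mem_Ioc]; omega
      · rw [disjoint_left]; intro x hx hx'; rw [mem_Icc] at hx; rw [mem_Ioc] at hx'; omega
    unfold pre at *
    rw [split] at hpa hpb
    rw [split, split (fun i => min (β i) m)] at h1
    have a1 : ∑ i ∈ Icc 1 k, min (α i) m = ∑ i ∈ Icc 1 k, m := by
      refine sum_congr rfl fun i hi => ?_
      rw [mem_Icc] at hi
      exact min_eq_right (hanti i k hi.1 hi.2 (by omega))
    have a2 : ∑ i ∈ Ioc k L, min (α i) m = ∑ i ∈ Ioc k L, α i := by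
      refine sum_congr rfl fun i hi => ?_
      rw [mem_Ioc] at hi
      by_cases hil : i ≤ la
      · exact min_eq_left (hanti k i (by omega) (by omega) hil)
      · rw [hasupp i (by omega)]; simp
    have b1 : ∑ i ∈ Icc 1 k, min (β i) m ≤ ∑ i ∈ Icc 1 k, m := sum_le_sum fun i _ => min_le_right _ _
    have b2 : ∑ i ∈ Ioc k L, min (β i) m ≤ ∑ i ∈ Ioc k L, β i := sum_le_sum fun i _ => min_le_left _ _
    omega

end S17

namespace S17
open Finset

lemma mem_iff {n l : ℕ} {β : ℕ → ℕ} {w : Equiv.Perm (Fin n)} :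
    MemCClassA n l β w ↔ ∃ I, IsDec l β (w * Fin.revPerm) I := by
  constructor
  · rintro ⟨I, h1, h2, h3, h4⟩; exact ⟨I, ⟨h1, h2, h3, h4⟩⟩
  · rintro ⟨I, ⟨h1, h2, h3, h4⟩⟩; exact ⟨I, h1, h2, h3, h4⟩

lemma rev_rev {n : ℕ} (c : Equiv.Perm (Fin n)) : c * Fin.revPerm * Fin.revPerm = c := by
  have hrr : (Fin.revPerm * Fin.revPerm : Equiv.Perm (Fin n)) = 1 := by ext x; simp
  rw [mul_assoc, hrr, mul_one]

lemma canon_min {n l : ℕ} {β : ℕ → ℕ} (hmono : ∀ i, 1 ≤ i → i < l → β (i + 1) ≤ β i)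
    (hsupp : ∀ i, l < i → β i = 0) (hsum : pre β l = n)
    (hodd : ∀ i, 1 ≤ i → i ≤ l → Odd (β i)) {τ : Equiv.Perm (Fin n)} (hc : IsCanon (pre β) τ) :
    MemCClassA n l β (conj τ * Fin.revPerm) ∧
      ∀ v, MemCClassA n l β v → invA (conj τ * Fin.revPerm) ≤ invA v := by
  constructor
  · rw [mem_iff, rev_rev]
    exact ⟨_, canon_dec hsupp hsum hodd hc⟩
  · intro v hv
    obtain ⟨I, hI⟩ := mem_iff.mp hv
    have h1 := hI.K_lower hodd
    have h2 := canon_K hmono hsupp hsum hodd hc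
    have h3 := K_inv v
    have h4 := K_inv (conj τ * Fin.revPerm)
    rw [rev_rev] at h4
    omega

end S17

theorem stmt17 (n : ℕ) (hn : 1 ≤ n)
    (ℓa : ℕ) (α : ℕ → ℕ)
    (hamono : ∀ i, 1 ≤ i → i < ℓa → α (i + 1) ≤ α i)
    (hapos : ∀ i, 1 ≤ i → i ≤ ℓa → 0 < α i)
    (hasupp : ∀ i, ℓa < i → α i = 0)
    (hasum : ∑ i ∈ Finset.Icc 1 ℓa, α i = n)
    (haodd : ∀ i, 1 ≤ i → i ≤ ℓa → Odd (α i))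
    (ℓb : ℕ) (β : ℕ → ℕ)
    (hbmono : ∀ i, 1 ≤ i → i < ℓb → β (i + 1) ≤ β i)
    (hbpos : ∀ i, 1 ≤ i → i ≤ ℓb → 0 < β i)
    (hbsupp : ∀ i, ℓb < i → β i = 0)
    (hbsum : ∑ i ∈ Finset.Icc 1 ℓb, β i = n)
    (hbodd : ∀ i, 1 ≤ i → i ≤ ℓb → Odd (β i)) :
    (∃ w w' : Equiv.Perm (Fin n),
      MemCClassA n ℓb β w ∧ (∀ v, MemCClassA n ℓb β v → invA w ≤ invA v) ∧
      MemCClassA n ℓa α w' ∧ (∀ v, MemCClassA n ℓa α v → invA w' ≤ invA v) ∧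
      BruhatA w' w) ↔
    (∀ k, ∑ i ∈ Finset.Icc 1 k, β i ≤ ∑ i ∈ Finset.Icc 1 k, α i) := by
  have hva : S17.Valid n (S17.pre α) := S17.pre_valid hasupp hasum haodd
  have hvb : S17.Valid n (S17.pre β) := S17.pre_valid hbsupp hbsum hbodd
  obtain ⟨τ, hτ⟩ := S17.exists_canon hn hvb
  have hmin := S17.canon_min hbmono hbsupp hbsum hbodd hτ
  constructor
  · rintro ⟨w, w', hw, hwm, hw', _, hB⟩
    obtain ⟨I, hI⟩ := S17.mem_iff.mp hw
    obtain ⟨I', hI'⟩ := S17.mem_iff.mp hw'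
    have hl : 1 ≤ ℓb := by
      rcases Nat.eq_zero_or_pos ℓb with h | h
      · subst h; simp at hbsum; omega
      · exact h
    have h1 := hwm _ hmin.1
    have h2 := S17.canon_K hbmono hbsupp hbsum hbodd hτ
    have h3 := S17.K_inv w
    have h4 := S17.K_inv (S17.conj τ * Fin.revPerm)
    rw [S17.rev_rev] at h4
    have ht := hI.tight hbodd (by omega)
    intro k
    exact S17.dom_of_phi hamono hasupp hasum haodd hbsupp hbsum
      (S17.phi_le hl hI hbodd (fun i hi j hj => ht i j hi hj) hI' haodd (S17.bruhat_cost w' w hB)) k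
  · intro h
    obtain ⟨τ', hτ', hu⟩ := S17.chain hn hva _ (S17.pre β) τ hvb hτ h rfl
    have hmin' := S17.canon_min hamono hasupp hasum haodd hτ'
    exact ⟨_, _, hmin.1, hmin.2, hmin'.1, hmin'.2, hu.bruhat⟩
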